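/- For the KCIP on the torus Λ(L,d) with parameter p=c/n, there exist constants C₁,C₂ and N depending only on c and d such that for every 0<ε≤1/(96c²(d+1)³), every n>N, every initial configuration x, and every integer s with n·log(n) ≤ s ≤ n³/(96c²d³): E_x[Ỹ_s] ≤ (1+C₁ε)·Ỹ_0(x) + C₂. -/

import Mathlib

open scoped Classical
open Finset

noncomputable section

/-- The number of particles (vertices labelled `1`) of a configuration. -/
def numParticles {V : Type*} [Fintype V] (x : V → Bool) : ℕ :=
  (Finset.univ.filter fun v => x v = true).card

/-- One-step transition kernel of the kinetically constrained Ising process (KCIP)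
on the graph `G` with density parameter `p`: a uniformly chosen vertex `v` is updated,
and its label is resampled (to `1` with probability `p`, to `0` otherwise) iff `v` has at
least one neighbour labelled `1`. -/
def kcipKernel {V : Type*} [Fintype V] (G : SimpleGraph V) (p : ℝ) (x y : V → Bool) : ℝ :=
  ((Fintype.card V : ℝ))⁻¹ * ∑ v : V,
    (if ∀ w, w ≠ v → y w = x w then
      (if ∃ u, G.Adj u v ∧ x u = true then (if y v = true then p else 1 - p)
       else (if y v = x v then 1 else 0))
     else 0)

/-- Probability that the Markov chain with kernel `K` started at `x` produces a
trajectory `(X_0, …, X_T)` lying in the event `A`. -/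
def trajProb {Ω : Type*} [Fintype Ω] (K : Ω → Ω → ℝ) (x : Ω) (T : ℕ)
    (A : (Fin (T + 1) → Ω) → Prop) : ℝ :=
  ∑ ω : Fin (T + 1) → Ω,
    if ω 0 = x ∧ A ω then ∏ i : Fin T, K (ω i.castSucc) (ω i.succ) else 0

/-- Expectation of a functional `f` of the trajectory `(X_0, …, X_T)` of the Markov chain
with kernel `K` started at `x`. -/
def trajExp {Ω : Type*} [Fintype Ω] (K : Ω → Ω → ℝ) (x : Ω) (T : ℕ)
    (f : (Fin (T + 1) → Ω) → ℝ) : ℝ :=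
  ∑ ω : Fin (T + 1) → Ω,
    (if ω 0 = x then ∏ i : Fin T, K (ω i.castSucc) (ω i.succ) else 0) * f ω

/-- The `d`-dimensional discrete torus `Z_L^d`: vertices are `Fin d → ZMod L`, with an edge
between `u` and `v` iff `u - v = ± e_i` for some coordinate vector `e_i`. -/
def torusGraph (L d : ℕ) : SimpleGraph (Fin d → ZMod L) :=
  SimpleGraph.fromRel fun u v => ∃ i : Fin d, v = u + fun j => if j = i then (1 : ZMod L) else 0

/-- The corrected component count `N_H` of the subgraph of `G` induced by the vertex set `H`:
if `H` spans no edge of `G` then `N_H = |H|`; otherwise, with `W(H)` the set of vertices of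
`H` having at least one neighbour in `H`, `N_H = |W(H)|⁻¹ Σ_{v ∈ W(H)} N_{H∖{v}}`.
Equivalently, it is the expected number of vertices remaining when one repeatedly deletes a
uniformly chosen vertex having at least one neighbour, until no edges remain. -/
def correctedCount {V : Type*} [DecidableEq V] (G : SimpleGraph V) (H : Finset V) : ℝ :=
  if (H.filter fun v => ∃ u ∈ H, G.Adj u v).Nonempty then
    (((H.filter fun v => ∃ u ∈ H, G.Adj u v).card : ℝ))⁻¹ *
      ∑ v ∈ (H.filter fun v => ∃ u ∈ H, G.Adj u v).attach,
        correctedCount G (H.erase v.val)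
  else (H.card : ℝ)
termination_by H.card
decreasing_by
  exact Finset.card_erase_lt_of_mem (Finset.mem_of_mem_filter _ v.2)

/-- The corrected number of components `Ỹ(x)`: the sum of the corrected component counts over
the connected components of the subgraph induced by the particles of `x`. -/
def correctedY {V : Type*} [Fintype V] [DecidableEq V] (G : SimpleGraph V)
    (x : V → Bool) : ℝ :=
  ∑ C : (G.induce {v | x v = true}).ConnectedComponent,
    correctedCount G (Set.toFinite (Subtype.val '' C.supp)).toFinset

/-! ### The deletion process -/

section Deletion

set_option linter.unusedSectionVars false

variable {V : Type*} [DecidableEq V] (G : SimpleGraph V)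

/-- The vertices of `S` having at least one neighbour in `S`. -/
def activeSet (S : Finset V) : Finset V :=
  S.filter fun v => ∃ u ∈ S, G.Adj u v

/-- The expected value of `f` at the final set of the process that, started from `S`, deletes
uniformly chosen vertices with a remaining neighbour until no edge remains. -/
def finalExp (f : Finset V → ℝ) (S : Finset V) : ℝ :=
  if (activeSet G S).Nonempty then
    ((activeSet G S).card : ℝ)⁻¹ *
      ∑ v ∈ (activeSet G S).attach, finalExp f (S.erase v.val)
  else f S
termination_by S.card
decreasing_by
  exact Finset.card_erase_lt_of_mem (Finset.mem_of_mem_filter _ v.2)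

variable {G}

theorem mem_activeSet {S : Finset V} {v : V} :
    v ∈ activeSet G S ↔ v ∈ S ∧ ∃ u ∈ S, G.Adj u v := by
  simp [activeSet]

theorem activeSet_subset (S : Finset V) : activeSet G S ⊆ S := Finset.filter_subset _ _

theorem activeSet_mono {S T : Finset V} (h : S ⊆ T) : activeSet G S ⊆ activeSet G T := by
  intro v hv
  rw [mem_activeSet] at hv ⊢
  obtain ⟨h1, u, hu, huv⟩ := hv
  exact ⟨h h1, u, h hu, huv⟩

theorem finalExp_of_activeSet_eq_empty {f : Finset V → ℝ} {S : Finset V}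
    (h : activeSet G S = ∅) : finalExp G f S = f S := by
  rw [finalExp, if_neg (by simp [h])]

theorem card_mul_finalExp (f : Finset V → ℝ) (S : Finset V) :
    ((activeSet G S).card : ℝ) * finalExp G f S
      = ∑ v ∈ activeSet G S, finalExp G f (S.erase v) := by
  by_cases h : (activeSet G S).Nonempty
  · rw [finalExp, if_pos h, ← mul_assoc, mul_inv_cancel₀, one_mul,
      Finset.sum_attach (activeSet G S) fun v => finalExp G f (S.erase v)]
    exact_mod_cast h.card_pos.ne'
  · rw [Finset.not_nonempty_iff_eq_empty.mp h]
    simp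

theorem sum_finalExp_erase_sub (f : Finset V → ℝ) (S : Finset V) :
    ∑ v ∈ activeSet G S, (finalExp G f (S.erase v) - finalExp G f S) = 0 := by
  rw [Finset.sum_sub_distrib, ← card_mul_finalExp]
  simp

/-- Induction along the deletion process. -/
theorem deletion_induction {P : Finset V → Prop} (base : ∀ S, activeSet G S = ∅ → P S)
    (step : ∀ S, (activeSet G S).Nonempty → (∀ v ∈ activeSet G S, P (S.erase v)) → P S)
    (S : Finset V) : P S := by
  induction hn : S.card using Nat.strong_induction_on generalizing S with
  | _ n ih =>
    by_cases h : (activeSet G S).Nonempty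
    · refine step S h fun v hv => ih _ ?_ _ rfl
      rw [← hn]
      exact Finset.card_erase_lt_of_mem (activeSet_subset S hv)
    · exact base S (Finset.not_nonempty_iff_eq_empty.mp h)

/-- Final sets contain all vertices that are isolated at the start. -/
theorem finalExp_mono {f g : Finset V → ℝ} (S : Finset V)
    (h : ∀ F, F ⊆ S → S \ activeSet G S ⊆ F → f F ≤ g F) :
    finalExp G f S ≤ finalExp G g S := by
  induction S using deletion_induction (G := G) with
  | base S hS =>
    rw [finalExp_of_activeSet_eq_empty hS, finalExp_of_activeSet_eq_empty hS]
    exact h S subset_rfl sdiff_subset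
  | step S hS ih =>
    have hpos : (0 : ℝ) < (activeSet G S).card := by exact_mod_cast hS.card_pos
    refine le_of_mul_le_mul_left ?_ hpos
    rw [card_mul_finalExp, card_mul_finalExp]
    refine Finset.sum_le_sum fun v hv => ih v hv fun F hF hF' => ?_
    refine h F (hF.trans (erase_subset _ _)) fun w hw => hF' ?_
    rw [mem_sdiff] at hw ⊢
    refine ⟨mem_erase.mpr ⟨fun e => hw.2 (e ▸ hv), hw.1⟩, fun hw' => hw.2 ?_⟩
    exact activeSet_mono (erase_subset _ _) hw'

theorem finalExp_congr {f g : Finset V → ℝ} (S : Finset V)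
    (h : ∀ F, F ⊆ S → S \ activeSet G S ⊆ F → f F = g F) :
    finalExp G f S = finalExp G g S :=
  le_antisymm (finalExp_mono S fun F h1 h2 => (h F h1 h2).le)
    (finalExp_mono S fun F h1 h2 => (h F h1 h2).ge)

theorem finalExp_add (f g : Finset V → ℝ) (S : Finset V) :
    finalExp G (fun F => f F + g F) S = finalExp G f S + finalExp G g S := by
  induction S using deletion_induction (G := G) with
  | base S hS => simp only [finalExp_of_activeSet_eq_empty hS]
  | step S hS ih =>
    have hpos : ((activeSet G S).card : ℝ) ≠ 0 := by exact_mod_cast hS.card_pos.ne'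
    refine mul_left_cancel₀ hpos ?_
    rw [mul_add, card_mul_finalExp, card_mul_finalExp, card_mul_finalExp, ← Finset.sum_add_distrib]
    exact Finset.sum_congr rfl ih

theorem finalExp_const_mul (a : ℝ) (f : Finset V → ℝ) (S : Finset V) :
    finalExp G (fun F => a * f F) S = a * finalExp G f S := by
  induction S using deletion_induction (G := G) with
  | base S hS => simp only [finalExp_of_activeSet_eq_empty hS]
  | step S hS ih =>
    have hpos : ((activeSet G S).card : ℝ) ≠ 0 := by exact_mod_cast hS.card_pos.ne'
    refine mul_left_cancel₀ hpos ?_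
    rw [mul_left_comm, card_mul_finalExp, card_mul_finalExp, Finset.mul_sum]
    exact Finset.sum_congr rfl ih

theorem finalExp_const (a : ℝ) (S : Finset V) : finalExp G (fun _ => a) S = a := by
  induction S using deletion_induction (G := G) with
  | base S hS => simp only [finalExp_of_activeSet_eq_empty hS]
  | step S hS ih =>
    have hpos : ((activeSet G S).card : ℝ) ≠ 0 := by exact_mod_cast hS.card_pos.ne'
    refine mul_left_cancel₀ hpos ?_
    rw [card_mul_finalExp, Finset.sum_congr rfl ih]
    simp

theorem finalExp_sub (f g : Finset V → ℝ) (S : Finset V) :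
    finalExp G (fun F => f F - g F) S = finalExp G f S - finalExp G g S := by
  have h := finalExp_add (G := G) (fun F => f F - g F) g S
  simp only [sub_add_cancel] at h
  linarith

theorem finalExp_sum {ι : Type*} (s : Finset ι) (f : ι → Finset V → ℝ) (S : Finset V) :
    finalExp G (fun F => ∑ i ∈ s, f i F) S = ∑ i ∈ s, finalExp G (f i) S := by
  induction s using Finset.induction_on with
  | empty => simpa using finalExp_const (G := G) 0 S
  | insert i s hi ih => simp only [Finset.sum_insert hi, finalExp_add, ih]

theorem correctedCount_eq_finalExp (S : Finset V) :
    correctedCount G S = finalExp G (fun F => (F.card : ℝ)) S := by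
  induction S using deletion_induction (G := G) with
  | base S hS =>
    rw [finalExp_of_activeSet_eq_empty hS, correctedCount, if_neg]
    rw [Finset.not_nonempty_iff_eq_empty]
    exact hS
  | step S hS ih =>
    rw [finalExp, if_pos hS, correctedCount]
    refine (if_pos hS).trans ?_
    congr 1
    exact Finset.sum_congr rfl fun v _ => ih v.1 v.2

/-! ### Isolated vertices and insertion of a vertex -/

theorem activeSet_erase_of_notMem {S : Finset V} {w : V} (hw : w ∉ activeSet G S) :
    activeSet G (S.erase w) = activeSet G S := by
  refine (activeSet_mono (erase_subset _ _)).antisymm fun v hv => ?_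
  obtain ⟨h1, u, hu, huv⟩ := mem_activeSet.mp hv
  refine mem_activeSet.mpr ⟨mem_erase.mpr ⟨fun e => hw (e ▸ hv), h1⟩, u, mem_erase.mpr ⟨?_, hu⟩, huv⟩
  rintro rfl
  exact hw (mem_activeSet.mpr ⟨hu, v, h1, huv.symm⟩)

theorem notMem_activeSet_erase {S : Finset V} {w : V} (hw : w ∉ activeSet G S) (v : V) :
    w ∉ activeSet G (S.erase v) := fun h => hw (activeSet_mono (erase_subset _ _) h)

/-- The deletion process ignores an isolated vertex. -/
theorem finalExp_erase_isolated (f : Finset V → ℝ) {S : Finset V} {w : V}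
    (hw : w ∉ activeSet G S) :
    finalExp G f (S.erase w) = finalExp G (fun F => f (F.erase w)) S := by
  induction S using deletion_induction (G := G) with
  | base S hS =>
    rw [finalExp_of_activeSet_eq_empty hS,
      finalExp_of_activeSet_eq_empty (by rw [activeSet_erase_of_notMem hw, hS])]
  | step S hS ih =>
    have hpos : ((activeSet G S).card : ℝ) ≠ 0 := by exact_mod_cast hS.card_pos.ne'
    refine mul_left_cancel₀ hpos ?_
    rw [card_mul_finalExp, ← activeSet_erase_of_notMem hw, card_mul_finalExp,
      activeSet_erase_of_notMem hw]
    refine Finset.sum_congr rfl fun v hv => ?_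
    rw [erase_right_comm]
    exact ih v hv (notMem_activeSet_erase hw v)

theorem activeSet_insert_of_isolated {S : Finset V} {v : V} (hv : ∀ u ∈ S, ¬ G.Adj u v) :
    activeSet G (insert v S) = activeSet G S := by
  refine Subset.antisymm (fun w hw => ?_) (activeSet_mono (subset_insert _ _))
  obtain ⟨h1, u, hu, huw⟩ := mem_activeSet.mp hw
  have hwv : w ≠ v := by
    rintro rfl
    rcases mem_insert.mp hu with rfl | hu
    · exact huw.ne rfl
    · exact hv u hu huw
  have hwS := (mem_insert.mp h1).resolve_left hwv
  refine mem_activeSet.mpr ⟨hwS, u, (mem_insert.mp hu).resolve_left ?_, huw⟩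
  rintro rfl
  exact hv w hwS huw.symm

theorem finalExp_insert_isolated (f : Finset V → ℝ) {S : Finset V} {v : V} (hvS : v ∉ S)
    (hv : ∀ u ∈ S, ¬ G.Adj u v) :
    finalExp G f (insert v S) = finalExp G (fun F => f (insert v F)) S := by
  have h := finalExp_erase_isolated (G := G) (fun F => f (insert v F)) (S := insert v S) (w := v)
    (by
      rw [activeSet_insert_of_isolated hv]
      exact fun h => hvS (activeSet_subset S h))
  rw [erase_insert hvS] at h
  rw [h]
  refine finalExp_congr _ fun F _ hF => ?_
  have : v ∈ F := hF (by
    rw [activeSet_insert_of_isolated hv, mem_sdiff]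
    exact ⟨mem_insert_self _ _, fun h => hvS (activeSet_subset S h)⟩)
  rw [insert_erase this]

theorem finalExp_relabel_isolated (f : Finset V → ℝ) {S : Finset V} {u v : V}
    (hu : u ∉ activeSet G S) (hvS : v ∉ S) (hv : ∀ w ∈ S.erase u, ¬ G.Adj w v) :
    finalExp G f (insert v (S.erase u)) = finalExp G (fun F => f (insert v (F.erase u))) S := by
  rw [finalExp_insert_isolated f (fun h => hvS (mem_of_mem_erase h)) hv,
    finalExp_erase_isolated _ hu]

theorem finalExp_card_erase_isolated {S : Finset V} {w : V} (hwS : w ∈ S)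
    (hw : w ∉ activeSet G S) :
    finalExp G (fun F => (F.card : ℝ)) (S.erase w)
      = finalExp G (fun F => (F.card : ℝ)) S - 1 := by
  rw [finalExp_erase_isolated _ hw, ← finalExp_const (G := G) 1 S, ← finalExp_sub]
  refine finalExp_congr _ fun F _ hF => ?_
  have hwF : w ∈ F := hF (mem_sdiff.mpr ⟨hwS, hw⟩)
  rw [card_erase_of_mem hwF, Nat.cast_pred (card_pos.mpr ⟨w, hwF⟩)]

/-- The neighbours of `v` in `S`. -/
def nbrsIn (G : SimpleGraph V) (v : V) (S : Finset V) : Finset V := S.filter fun u => G.Adj u v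

theorem mem_nbrsIn {v u : V} {S : Finset V} : u ∈ nbrsIn G v S ↔ u ∈ S ∧ G.Adj u v := by
  simp [nbrsIn]

theorem activeSet_insert {S : Finset V} {v : V} (hne : (nbrsIn G v S).Nonempty) :
    activeSet G (insert v S) = insert v (activeSet G S ∪ nbrsIn G v S) := by
  ext w
  simp only [mem_activeSet, mem_insert, mem_union, mem_nbrsIn]
  obtain ⟨u₀, hu₀⟩ := hne
  rw [mem_nbrsIn] at hu₀
  constructor
  · rintro ⟨rfl | hw, u, rfl | hu, huw⟩
    · exact Or.inl rfl
    · exact Or.inl rfl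
    · exact Or.inr (Or.inr ⟨hw, huw.symm⟩)
    · exact Or.inr (Or.inl ⟨hw, u, hu, huw⟩)
  · rintro (rfl | ⟨hw, u, hu, huw⟩ | ⟨hw, hwv⟩)
    · exact ⟨Or.inl rfl, u₀, Or.inr hu₀.1, hu₀.2⟩
    · exact ⟨Or.inr hw, u, Or.inr hu, huw⟩
    · exact ⟨Or.inr hw, v, Or.inl rfl, hwv.symm⟩

/-- Adding a vertex `v` changes the expectation of a Lipschitz function by at most
`1 + deg v` times the Lipschitz constant. -/
theorem abs_finalExp_insert_sub_le {g : Finset V → ℝ} {ℓ : ℝ}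
    (hg : ∀ F x, x ∉ F → |g (insert x F) - g F| ≤ ℓ) (v : V) (S : Finset V) (hv : v ∉ S) :
    |finalExp G g (insert v S) - finalExp G g S| ≤ (1 + (nbrsIn G v S).card) * ℓ := by
  have hℓ : 0 ≤ ℓ := (abs_nonneg _).trans (hg S v hv)
  induction hn : S.card using Nat.strong_induction_on generalizing S with
  | _ n ih =>
  rcases (nbrsIn G v S).eq_empty_or_nonempty with he | hne
  · have hv' : ∀ u ∈ S, ¬ G.Adj u v := fun u hu huv => by
      have : u ∈ nbrsIn G v S := mem_nbrsIn.mpr ⟨hu, huv⟩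
      simp [he] at this
    rw [finalExp_insert_isolated g hv hv', ← finalExp_sub, abs_le]
    simp only [he, card_empty, Nat.cast_zero, add_zero, one_mul]
    constructor
    · rw [← finalExp_const (G := G) (-ℓ) S]
      exact finalExp_mono _ fun F hF _ => (abs_le.mp (hg F v fun h => hv (hF h))).1
    · conv_rhs => rw [← finalExp_const (G := G) ℓ S]
      exact finalExp_mono _ fun F hF _ => (abs_le.mp (hg F v fun h => hv (hF h))).2
  set R := finalExp G g with hR
  set T := insert v S with hT
  set b : ℝ := (1 + (nbrsIn G v S).card) * ℓ with hb
  have hvA : v ∉ activeSet G S := fun h => hv (activeSet_subset S h)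
  have hact : activeSet G T = insert v (activeSet G S ∪ nbrsIn G v S) := activeSet_insert hne
  have hvU : v ∉ activeSet G S ∪ nbrsIn G v S := by
    rw [mem_union, mem_nbrsIn]
    exact fun h => h.elim hvA fun h => hv h.1
  have hcard : (0 : ℝ) < (activeSet G T).card := by
    rw [hact]; exact_mod_cast card_pos.mpr (insert_nonempty _ _)
  have hsplit : ((activeSet G T).card : ℝ) * (R T - R S)
      = ∑ w ∈ activeSet G S, (R (T.erase w) - R (S.erase w))
        + ∑ w ∈ nbrsIn G v S \ activeSet G S, (R (T.erase w) - R S) := by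
    have h1 : ((activeSet G T).card : ℝ) * (R T - R S)
        = ∑ w ∈ activeSet G T, (R (T.erase w) - R S) := by
      rw [hR, mul_sub, card_mul_finalExp, Finset.sum_sub_distrib, sum_const, nsmul_eq_mul]
    have h2 := sum_finalExp_erase_sub (G := G) g S
    rw [h1, hact, sum_insert hvU, ← union_sdiff_self_eq_union,
      sum_union disjoint_sdiff, hT, erase_insert hv, sub_self, zero_add]
    congr 1
    rw [← sub_eq_zero, ← Finset.sum_sub_distrib, ← h2]
    exact Finset.sum_congr rfl fun w _ => by ring
  have hact1 : ∀ w ∈ activeSet G S, |R (T.erase w) - R (S.erase w)| ≤ b := by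
    intro w hw
    have hwS := activeSet_subset S hw
    have hwv : w ≠ v := fun e => hv (e ▸ hwS)
    have h1 := ih (S.erase w).card (by rw [← hn]; exact card_erase_lt_of_mem hwS)
      (S.erase w) (fun h => hv (mem_of_mem_erase h)) rfl
    rw [hT, erase_insert_of_ne hwv.symm]
    refine h1.trans ?_
    have : (nbrsIn G v (S.erase w)).card ≤ (nbrsIn G v S).card :=
      card_le_card (filter_subset_filter _ (erase_subset _ _))
    rw [hb]
    gcongr
  have hact2 : ∀ w ∈ nbrsIn G v S \ activeSet G S, |R (T.erase w) - R S| ≤ b := by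
    intro w hw
    rw [mem_sdiff] at hw
    have hwS := (mem_nbrsIn.mp hw.1).1
    have hwv : w ≠ v := fun e => hv (e ▸ hwS)
    have h1 := ih (S.erase w).card (by rw [← hn]; exact card_erase_lt_of_mem hwS)
      (S.erase w) (fun h => hv (mem_of_mem_erase h)) rfl
    have h2 : |R (S.erase w) - R S| ≤ ℓ := by
      have hlip : ∀ F, S \ activeSet G S ⊆ F → |g (F.erase w) - g F| ≤ ℓ := fun F hF => by
        have := hg (F.erase w) w (notMem_erase _ _)
        rwa [insert_erase (hF (mem_sdiff.mpr ⟨hwS, hw.2⟩)), abs_sub_comm] at this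
      rw [hR, finalExp_erase_isolated g hw.2, ← finalExp_sub, abs_le]
      constructor
      · rw [← finalExp_const (G := G) (-ℓ) S]
        exact finalExp_mono _ fun F _ hF => (abs_le.mp (hlip F hF)).1
      · conv_rhs => rw [← finalExp_const (G := G) ℓ S]
        exact finalExp_mono _ fun F _ hF => (abs_le.mp (hlip F hF)).2
    have h3 : ((nbrsIn G v (S.erase w)).card : ℝ) = (nbrsIn G v S).card - 1 := by
      have : nbrsIn G v (S.erase w) = (nbrsIn G v S).erase w := by
        ext x; simp only [mem_nbrsIn, mem_erase]; tauto
      rw [this, card_erase_of_mem hw.1, Nat.cast_pred (card_pos.mpr ⟨w, hw.1⟩)]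
    rw [h3] at h1
    rw [hT, erase_insert_of_ne hwv.symm]
    calc |R (insert v (S.erase w)) - R S|
        ≤ |R (insert v (S.erase w)) - R (S.erase w)| + |R (S.erase w) - R S| := abs_sub_le _ _ _
      _ ≤ (1 + ((nbrsIn G v S).card - 1)) * ℓ + ℓ := add_le_add h1 h2
      _ = b := by rw [hb]; ring
  have hb0 : 0 ≤ b := by rw [hb]; positivity
  have hbound : ((activeSet G T).card : ℝ) * |R T - R S| ≤ (activeSet G T).card * b := by
    rw [← abs_of_pos hcard, ← abs_mul, abs_of_pos hcard, hsplit]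
    calc _ ≤ ∑ w ∈ activeSet G S, b + ∑ w ∈ nbrsIn G v S \ activeSet G S, b :=
          (abs_add_le _ _).trans (add_le_add
            ((abs_sum_le_sum_abs _ _).trans (sum_le_sum hact1))
            ((abs_sum_le_sum_abs _ _).trans (sum_le_sum hact2)))
      _ = ((activeSet G S ∪ nbrsIn G v S).card : ℝ) * b := by
          rw [← sum_union disjoint_sdiff, union_sdiff_self_eq_union, sum_const, nsmul_eq_mul]
      _ ≤ _ := by
          rw [hact]
          gcongr
          exact subset_insert _ _
  exact le_of_mul_le_mul_left hbound hcard

/-- Adding a vertex whose only neighbour `u` is isolated makes the particle at `u` move to the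
new vertex with probability one half. -/
theorem finalExp_insert_of_nbrsIn_eq_singleton (f : Finset V → ℝ) {u v : V} {S : Finset V}
    (hv : v ∉ S) (hu : u ∉ activeSet G S) (hN : nbrsIn G v S = {u}) :
    finalExp G f (insert v S)
      = (finalExp G f S + finalExp G (fun F => f (insert v (F.erase u))) S) / 2 := by
  induction hn : S.card using Nat.strong_induction_on generalizing S with
  | _ n ih =>
  have huN : u ∈ nbrsIn G v S := by rw [hN]; exact mem_singleton_self _
  have huS := (mem_nbrsIn.mp huN).1
  have huv : u ≠ v := fun e => hv (e ▸ huS)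
  have hvA : v ∉ activeSet G S := fun h => hv (activeSet_subset S h)
  have hact : activeSet G (insert v S) = insert v (insert u (activeSet G S)) := by
    rw [activeSet_insert ⟨u, huN⟩, hN, union_comm, ← insert_eq]
  have hvU : v ∉ insert u (activeSet G S) := by
    rw [mem_insert]
    exact fun h => h.elim (fun e => huv e.symm) hvA
  have hadj : ∀ w ∈ S.erase u, ¬ G.Adj w v := fun w hw hwv => by
    have : w ∈ nbrsIn G v S := mem_nbrsIn.mpr ⟨mem_of_mem_erase hw, hwv⟩
    rw [hN, mem_singleton] at this
    exact (mem_erase.mp hw).1 this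
  have h1 := card_mul_finalExp (G := G) f (insert v S)
  rw [hact, sum_insert hvU, sum_insert hu, card_insert_of_notMem hvU, card_insert_of_notMem hu,
    erase_insert hv, erase_insert_of_ne huv.symm, finalExp_relabel_isolated f hu hv hadj] at h1
  have h2 : ∑ w ∈ activeSet G S, finalExp G f ((insert v S).erase w)
      = (activeSet G S).card *
        ((finalExp G f S + finalExp G (fun F => f (insert v (F.erase u))) S) / 2) := by
    rw [← mul_div_assoc, mul_add, card_mul_finalExp, card_mul_finalExp, ← sum_add_distrib,
      Finset.sum_div]
    refine Finset.sum_congr rfl fun w hw => ?_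
    have hwS := activeSet_subset S hw
    have hwv : w ≠ v := fun e => hv (e ▸ hwS)
    have hwu : w ≠ u := fun e => hu (e ▸ hw)
    rw [erase_insert_of_ne hwv.symm]
    refine ih (S.erase w).card (by rw [← hn]; exact card_erase_lt_of_mem hwS)
      (fun h => hv (mem_of_mem_erase h)) (notMem_activeSet_erase hu w) ?_ rfl
    have : nbrsIn G v (S.erase w) = (nbrsIn G v S).erase w := by
      ext x; simp only [mem_nbrsIn, mem_erase]; tauto
    rw [this, hN, erase_eq_of_notMem (by simpa using hwu)]
  rw [h2] at h1
  push_cast at h1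
  have h3 : (0 : ℝ) < (activeSet G S).card + 1 + 1 := by positivity
  refine mul_left_cancel₀ h3.ne' ?_
  linarith

/-- Adding a vertex all of whose neighbours are isolated cannot increase the corrected count, and
decreases it by at least `2 / 3` when there are two such neighbours. -/
theorem finalExp_card_insert_le {v : V} {S : Finset V} (hv : v ∉ S)
    (hiso : Disjoint (nbrsIn G v S) (activeSet G S)) (hne : (nbrsIn G v S).Nonempty) :
    finalExp G (fun F => (F.card : ℝ)) (insert v S)
      ≤ finalExp G (fun F => (F.card : ℝ)) S
        - if 2 ≤ (nbrsIn G v S).card then 2 / 3 else 0 := by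
  induction hn : S.card using Nat.strong_induction_on generalizing S with
  | _ n ih =>
  set N := finalExp G (fun F => (F.card : ℝ)) with hNdef
  have hvA : v ∉ activeSet G S := fun h => hv (activeSet_subset S h)
  have herase : ∀ w, nbrsIn G v (S.erase w) = (nbrsIn G v S).erase w := fun w => by
    ext x; simp only [mem_nbrsIn, mem_erase]; tauto
  by_cases h2 : 2 ≤ (nbrsIn G v S).card
  · rw [if_pos h2]
    have hvU : v ∉ activeSet G S ∪ nbrsIn G v S := by
      rw [mem_union, mem_nbrsIn]
      exact fun h => h.elim hvA fun h => hv h.1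
    have h1 := card_mul_finalExp (G := G) (fun F => (F.card : ℝ)) (insert v S)
    rw [activeSet_insert hne, sum_insert hvU, sum_union hiso.symm, card_insert_of_notMem hvU,
      card_union_of_disjoint hiso.symm, erase_insert hv] at h1
    have h3 : ∑ w ∈ activeSet G S, N ((insert v S).erase w)
        ≤ (activeSet G S).card * (N S - 2 / 3) := by
      rw [mul_sub, card_mul_finalExp, ← nsmul_eq_mul, ← sum_const, ← sum_sub_distrib]
      refine sum_le_sum fun w hw => ?_
      have hwS := activeSet_subset S hw
      have hwv : w ≠ v := fun e => hv (e ▸ hwS)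
      have hwN : w ∉ nbrsIn G v S := fun h => (disjoint_left.mp hiso) h hw
      have hN : nbrsIn G v (S.erase w) = nbrsIn G v S := by
        rw [herase, erase_eq_of_notMem hwN]
      have := ih (S.erase w).card (by rw [← hn]; exact card_erase_lt_of_mem hwS)
        (S := S.erase w) (fun h => hv (mem_of_mem_erase h))
        (by rw [hN]; exact hiso.mono_right (activeSet_mono (erase_subset _ _)))
        (by rw [hN]; exact hne) rfl
      rw [hN, if_pos h2] at this
      rwa [erase_insert_of_ne hwv.symm]
    have h4 : ∑ w ∈ nbrsIn G v S, N ((insert v S).erase w)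
        ≤ (nbrsIn G v S).card * (N S - 1) := by
      rw [← nsmul_eq_mul, ← sum_const]
      refine sum_le_sum fun w hw => ?_
      have hwS := (mem_nbrsIn.mp hw).1
      have hwv : w ≠ v := fun e => hv (e ▸ hwS)
      have hwA : w ∉ activeSet G S := disjoint_left.mp hiso hw
      have := ih (S.erase w).card (by rw [← hn]; exact card_erase_lt_of_mem hwS)
        (S := S.erase w) (fun h => hv (mem_of_mem_erase h))
        (by
          rw [herase, activeSet_erase_of_notMem hwA]
          exact hiso.mono_left (erase_subset _ _))
        (by
          rw [herase, ← card_pos, card_erase_of_mem hw]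
          omega) rfl
      rw [hNdef, finalExp_card_erase_isolated hwS hwA] at this
      rw [erase_insert_of_ne hwv.symm]
      refine this.trans (sub_le_self _ ?_)
      split_ifs <;> norm_num
    have h5 : (2 : ℝ) ≤ (nbrsIn G v S).card := by exact_mod_cast h2
    push_cast at h1
    have h6 : (0 : ℝ) < (activeSet G S).card + (nbrsIn G v S).card + 1 := by positivity
    refine le_of_mul_le_mul_left ?_ h6
    rw [hNdef] at *
    nlinarith
  · rw [if_neg h2, sub_zero]
    obtain ⟨u, hu⟩ := card_eq_one.mp (le_antisymm (by omega) (card_pos.mpr hne))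
    have huN : u ∈ nbrsIn G v S := by rw [hu]; exact mem_singleton_self _
    have huA := disjoint_left.mp hiso huN
    rw [hNdef, finalExp_insert_of_nbrsIn_eq_singleton _ hv huA hu]
    have : finalExp G (fun F => ((insert v (F.erase u)).card : ℝ)) S
        = finalExp G (fun F => (F.card : ℝ)) S := by
      refine finalExp_congr _ fun F hF hF' => ?_
      have huF : u ∈ F := hF' (mem_sdiff.mpr ⟨(mem_nbrsIn.mp huN).1, huA⟩)
      rw [card_insert_of_notMem fun h => hv (hF (mem_of_mem_erase h)), card_erase_add_one huF]
    rw [this]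
    linarith

/-- The corrected count bounds the number of isolated vertices. -/
theorem card_le_activeSet_add_finalExp (S : Finset V) :
    (S.card : ℝ) ≤ (activeSet G S).card + finalExp G (fun F => (F.card : ℝ)) S := by
  have h1 : ((S \ activeSet G S).card : ℝ) ≤ finalExp G (fun F => (F.card : ℝ)) S := by
    rw [← finalExp_const (G := G) ((S \ activeSet G S).card : ℝ) S]
    exact finalExp_mono _ fun F _ hF => by exact_mod_cast card_le_card hF
  have h2 := card_sdiff_add_card_eq_card (activeSet_subset (G := G) S)
  rw [← h2]
  push_cast
  linarith

end Deletion

/-! ### The chain as an operator on functions of the particle set -/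

section Chain

variable {V : Type*} [Fintype V] [DecidableEq V] (G : SimpleGraph V) (p : ℝ)

/-- The empty vertices having at least one neighbour in `S`. -/
def outerBoundary (S : Finset V) : Finset V :=
  univ.filter fun v => v ∉ S ∧ ∃ u ∈ S, G.Adj u v

/-- One step of the KCIP as an operator on functions of the particle set. -/
def setStep (g : Finset V → ℝ) (S : Finset V) : ℝ :=
  g S + (1 - p) / Fintype.card V * ∑ v ∈ activeSet G S, (g (S.erase v) - g S)
    + p / Fintype.card V * ∑ v ∈ outerBoundary G S, (g (insert v S) - g S)

variable {G p}

theorem mem_outerBoundary {S : Finset V} {v : V} :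
    v ∈ outerBoundary G S ↔ v ∉ S ∧ ∃ u ∈ S, G.Adj u v := by
  simp [outerBoundary]

theorem nbrsIn_nonempty_of_mem_outerBoundary {S : Finset V} {v : V} (h : v ∈ outerBoundary G S) :
    (nbrsIn G v S).Nonempty := by
  obtain ⟨-, u, hu, huv⟩ := mem_outerBoundary.mp h
  exact ⟨u, mem_nbrsIn.mpr ⟨hu, huv⟩⟩

theorem setStep_add (g h : Finset V → ℝ) (S : Finset V) :
    setStep G p (fun S => g S + h S) S = setStep G p g S + setStep G p h S := by
  simp only [setStep, sum_sub_distrib, sum_add_distrib, sum_const, nsmul_eq_mul]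
  ring

theorem setStep_const_mul (a : ℝ) (g : Finset V → ℝ) (S : Finset V) :
    setStep G p (fun S => a * g S) S = a * setStep G p g S := by
  simp only [setStep, mul_add, ← mul_sub, ← mul_sum]
  ring

theorem setStep_mono (hp0 : 0 ≤ p) (hp1 : p ≤ 1) {g h : Finset V → ℝ} (hgh : ∀ S, g S ≤ h S)
    (S : Finset V) : setStep G p g S ≤ setStep G p h S := by
  rcases isEmpty_or_nonempty V with hV | hV
  · have h1 : activeSet G S = ∅ := eq_empty_of_isEmpty _
    have h2 : outerBoundary G S = ∅ := eq_empty_of_isEmpty _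
    simpa [setStep, h1, h2] using hgh S
  have hn : (0 : ℝ) < Fintype.card V := by exact_mod_cast Fintype.card_pos
  have hcard : ((activeSet G S).card : ℝ) + (outerBoundary G S).card ≤ Fintype.card V := by
    have hd : Disjoint (activeSet G S) (outerBoundary G S) := by
      rw [disjoint_left]
      intro v hv hv'
      exact (mem_outerBoundary.mp hv').1 (activeSet_subset S hv)
    rw [← Nat.cast_add, ← card_union_of_disjoint hd]
    exact_mod_cast card_le_univ _
  have key : ∀ f : Finset V → ℝ, Fintype.card V * setStep G p f S
      = (Fintype.card V - (1 - p) * (activeSet G S).card - p * (outerBoundary G S).card) * f S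
        + (1 - p) * ∑ v ∈ activeSet G S, f (S.erase v)
        + p * ∑ v ∈ outerBoundary G S, f (insert v S) := by
    intro f
    simp only [setStep, sum_sub_distrib, sum_const, nsmul_eq_mul]
    field_simp
    ring
  refine le_of_mul_le_mul_left ?_ hn
  rw [key, key]
  have hcoef : 0 ≤ (Fintype.card V : ℝ) - (1 - p) * (activeSet G S).card
      - p * (outerBoundary G S).card := by
    have h1 : (0 : ℝ) ≤ (activeSet G S).card := by positivity
    have h2 : (0 : ℝ) ≤ (outerBoundary G S).card := by positivity
    nlinarith
  have hq : 0 ≤ 1 - p := by linarith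
  gcongr
  · exact hgh S
  · exact hgh _
  · exact hgh _

theorem iterate_setStep_mono (hp0 : 0 ≤ p) (hp1 : p ≤ 1) {g h : Finset V → ℝ}
    (hgh : ∀ S, g S ≤ h S) (t : ℕ) (S : Finset V) :
    (setStep G p)^[t] g S ≤ (setStep G p)^[t] h S := by
  induction t generalizing g h with
  | zero => exact hgh S
  | succ t ih =>
    rw [Function.iterate_succ_apply, Function.iterate_succ_apply]
    exact ih fun S => setStep_mono hp0 hp1 hgh S

theorem setStep_add_const (g : Finset V → ℝ) (b : ℝ) (S : Finset V) :
    setStep G p (fun S => g S + b) S = setStep G p g S + b := by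
  simp only [setStep, add_sub_add_right_eq_sub]
  ring

theorem iterate_setStep_add_const (g : Finset V → ℝ) (b : ℝ) (t : ℕ) (S : Finset V) :
    (setStep G p)^[t] (fun S => g S + b) S = (setStep G p)^[t] g S + b := by
  induction t generalizing g with
  | zero => rfl
  | succ t ih =>
    rw [Function.iterate_succ_apply, Function.iterate_succ_apply, ← ih]
    rw [show setStep G p (fun S => g S + b) = fun S => setStep G p g S + b from
      funext fun S => setStep_add_const g b S]

end Chain

section Trajectories

set_option linter.unusedSectionVars false

theorem trajExp_zero {Ω : Type*} [Fintype Ω] (K : Ω → Ω → ℝ) (x : Ω) (F : Ω → ℝ) :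
    trajExp K x 0 (fun ω => F (ω (Fin.last 0))) = F x := by
  unfold trajExp
  rw [Fintype.sum_eq_single (fun _ => x)]
  · simp
  · intro ω hω
    rw [if_neg, zero_mul]
    intro h
    exact hω (funext fun i => by rw [← h]; congr 1; omega)

theorem trajExp_succ {Ω : Type*} [Fintype Ω] (K : Ω → Ω → ℝ) (x : Ω) (T : ℕ) (F : Ω → ℝ) :
    trajExp K x (T + 1) (fun ω => F (ω (Fin.last (T + 1))))
      = ∑ y, K x y * trajExp K y T (fun ω => F (ω (Fin.last T))) := by
  unfold trajExp
  rw [← (Fin.consEquiv fun _ : Fin (T + 2) => Ω).sum_comp, Fintype.sum_prod_type]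
  simp only [Fin.consEquiv_apply, Fin.cons_zero, Fin.prod_univ_succ, Fin.castSucc_zero,
    Fin.cons_succ, ← Fin.succ_castSucc, ← Fin.succ_last]
  rw [Fintype.sum_eq_single x (fun y hy => by simp [hy])]
  simp only [if_true]
  simp_rw [Finset.mul_sum]
  rw [Finset.sum_comm]
  refine Finset.sum_congr rfl fun ω _ => ?_
  rw [Fintype.sum_eq_single (ω 0) (fun y hy => by simp [hy.symm])]
  simp [mul_assoc]

variable {V : Type*} [Fintype V] [DecidableEq V] (G : SimpleGraph V) (p : ℝ)

/-- The set of particles of a configuration. -/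
def particles (x : V → Bool) : Finset V := univ.filter fun v => x v = true

theorem mem_particles {x : V → Bool} {v : V} : v ∈ particles x ↔ x v = true := by
  simp [particles]

theorem particles_update_true (x : V → Bool) (v : V) :
    particles (Function.update x v true) = insert v (particles x) := by
  ext w
  by_cases h : w = v
  · subst h; simp [mem_particles]
  · simp [mem_particles, h]

theorem particles_update_false (x : V → Bool) (v : V) :
    particles (Function.update x v false) = (particles x).erase v := by
  ext w
  by_cases h : w = v
  · subst h; simp [mem_particles]
  · simp [mem_particles, h]

theorem sum_ite_eq_off_vertex (x : V → Bool) (v : V) (h : (V → Bool) → ℝ) :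
    (∑ y : V → Bool, if ∀ w, w ≠ v → y w = x w then h y else 0)
      = h (Function.update x v true) + h (Function.update x v false) := by
  have hne : Function.update x v true ≠ Function.update x v false := fun e => by
    simpa using congrFun e v
  rw [← sum_filter, ← sum_pair hne]
  refine sum_congr ?_ fun _ _ => rfl
  ext y
  simp only [mem_filter, mem_univ, true_and, mem_insert, mem_singleton]
  constructor
  · intro hy
    have : y = Function.update x v (y v) := by
      funext w
      by_cases hw : w = v
      · subst hw; simp
      · simp [hw, hy w hw]
    rcases hyv : y v
    · right; rwa [hyv] at this
    · left; rwa [hyv] at this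
  · rintro (rfl | rfl) w hw <;> simp [hw]

theorem sum_kcipKernel_mul [Nonempty V] (g : Finset V → ℝ) (x : V → Bool) :
    ∑ y, kcipKernel G p x y * g (particles y) = setStep G p g (particles x) := by
  have hn : (Fintype.card V : ℝ) ≠ 0 := by exact_mod_cast Fintype.card_ne_zero
  set S := particles x with hS
  have hv : ∀ v, (∑ y : V → Bool, (if ∀ w, w ≠ v → y w = x w then
      (if ∃ u, G.Adj u v ∧ x u = true then (if y v = true then p else 1 - p)
       else (if y v = x v then 1 else 0)) else 0) * g (particles y))
      = g S + (1 - p) * (if v ∈ activeSet G S then g (S.erase v) - g S else 0)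
        + p * (if v ∈ outerBoundary G S then g (insert v S) - g S else 0) := by
    intro v
    simp only [ite_mul, zero_mul]
    rw [sum_ite_eq_off_vertex x v, particles_update_true, particles_update_false, ← hS]
    have hex : (∃ u, G.Adj u v ∧ x u = true) ↔ ∃ u ∈ S, G.Adj u v := by
      simp only [hS, mem_particles, and_comm]
    simp only [hex, mem_activeSet, mem_outerBoundary, Function.update_self]
    by_cases h1 : ∃ u ∈ S, G.Adj u v <;> by_cases h2 : v ∈ S
    · simp [h1, h2]; ring
    · simp [h1, h2]; ring
    · have : x v = true := mem_particles.mp h2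
      simp [h1, h2, this]
    · have : x v = false := by simpa [hS, mem_particles] using h2
      simp [h1, h2, this]
  simp only [kcipKernel, mul_assoc, ← mul_sum, sum_mul]
  rw [sum_comm]
  have hsum := sum_congr rfl fun v (_ : v ∈ univ) => hv v
  refine (congrArg (fun z => ((Fintype.card V : ℝ))⁻¹ * z) (Eq.trans ?_ hsum)).trans ?_
  · refine sum_congr rfl fun v _ => sum_congr rfl fun y _ => ?_
    congr
  simp only [sum_add_distrib, ← mul_sum, sum_const, nsmul_eq_mul, card_univ, setStep,
    sum_ite_mem, univ_inter]
  field_simp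

theorem trajExp_kcipKernel [Nonempty V] (g : Finset V → ℝ) (x : V → Bool) (T : ℕ) :
    trajExp (kcipKernel G p) x T (fun ω => g (particles (ω (Fin.last T))))
      = (setStep G p)^[T] g (particles x) := by
  induction T generalizing x with
  | zero => exact trajExp_zero _ x fun y => g (particles y)
  | succ T ih =>
    rw [trajExp_succ _ x T fun y => g (particles y), Function.iterate_succ_apply',
      ← sum_kcipKernel_mul]
    exact Finset.sum_congr rfl fun y _ => by rw [ih]

end Trajectories

/-! ### Additivity of the corrected count over components -/

section Components

variable {V : Type*} [DecidableEq V] {G : SimpleGraph V}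

theorem activeSet_union {A B : Finset V} (hadj : ∀ a ∈ A, ∀ b ∈ B, ¬ G.Adj a b) :
    activeSet G (A ∪ B) = activeSet G A ∪ activeSet G B := by
  ext v
  simp only [mem_activeSet, mem_union]
  constructor
  · rintro ⟨hv | hv, u, hu | hu, huv⟩
    · exact Or.inl ⟨hv, u, hu, huv⟩
    · exact (hadj v hv u hu huv.symm).elim
    · exact (hadj u hu v hv huv).elim
    · exact Or.inr ⟨hv, u, hu, huv⟩
  · rintro (⟨hv, u, hu, huv⟩ | ⟨hv, u, hu, huv⟩)
    · exact ⟨Or.inl hv, u, Or.inl hu, huv⟩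
    · exact ⟨Or.inr hv, u, Or.inr hu, huv⟩

theorem finalExp_card_union {A B : Finset V} (hd : Disjoint A B)
    (hadj : ∀ a ∈ A, ∀ b ∈ B, ¬ G.Adj a b) :
    finalExp G (fun F => (F.card : ℝ)) (A ∪ B)
      = finalExp G (fun F => (F.card : ℝ)) A + finalExp G (fun F => (F.card : ℝ)) B := by
  induction hn : (A ∪ B).card using Nat.strong_induction_on generalizing A B with
  | _ n ih =>
  have hact := activeSet_union hadj
  by_cases h : (activeSet G (A ∪ B)).Nonempty
  · have hpos : ((activeSet G (A ∪ B)).card : ℝ) ≠ 0 := by exact_mod_cast h.card_pos.ne'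
    have hdA : Disjoint (activeSet G A) (activeSet G B) :=
      hd.mono (activeSet_subset A) (activeSet_subset B)
    refine mul_left_cancel₀ hpos ?_
    rw [card_mul_finalExp, hact, sum_union hdA, card_union_of_disjoint hdA]
    have h1 : ∀ v ∈ activeSet G A, finalExp G (fun F => (F.card : ℝ)) ((A ∪ B).erase v)
        = finalExp G (fun F => (F.card : ℝ)) (A.erase v)
          + finalExp G (fun F => (F.card : ℝ)) B := fun v hv => by
      have hvA := activeSet_subset A hv
      have hvB := disjoint_left.mp hd hvA
      rw [erase_union_distrib, erase_eq_of_notMem hvB]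
      refine ih (A.erase v ∪ B).card ?_ (hd.mono_left (erase_subset _ _))
        (fun a ha => hadj a (mem_of_mem_erase ha)) rfl
      rw [← hn]
      refine card_lt_card ⟨union_subset_union_left (erase_subset _ _), fun hsub => ?_⟩
      simpa [hvB] using hsub (mem_union_left B hvA)
    have h2 : ∀ v ∈ activeSet G B, finalExp G (fun F => (F.card : ℝ)) ((A ∪ B).erase v)
        = finalExp G (fun F => (F.card : ℝ)) A
          + finalExp G (fun F => (F.card : ℝ)) (B.erase v) := fun v hv => by
      have hvB := activeSet_subset B hv
      have hvA := disjoint_right.mp hd hvB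
      rw [erase_union_distrib, erase_eq_of_notMem hvA]
      refine ih (A ∪ B.erase v).card ?_ (hd.mono_right (erase_subset _ _))
        (fun a ha b hb => hadj a ha b (mem_of_mem_erase hb)) rfl
      rw [← hn]
      refine card_lt_card ⟨union_subset_union_right (erase_subset _ _), fun hsub => ?_⟩
      simpa [hvA] using hsub (mem_union_right A hvB)
    rw [sum_congr rfl h1, sum_congr rfl h2, sum_add_distrib, sum_add_distrib,
      ← card_mul_finalExp, ← card_mul_finalExp]
    simp only [sum_const, nsmul_eq_mul]
    push_cast
    ring
  · rw [not_nonempty_iff_eq_empty] at h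
    have h' := h
    rw [hact, union_eq_empty] at h'
    rw [finalExp_of_activeSet_eq_empty h, finalExp_of_activeSet_eq_empty h'.1,
      finalExp_of_activeSet_eq_empty h'.2, card_union_of_disjoint hd]
    push_cast
    ring

theorem finalExp_card_biUnion {ι : Type*} [DecidableEq ι] (s : Finset ι) (A : ι → Finset V)
    (hd : ∀ i j, i ≠ j → Disjoint (A i) (A j))
    (hadj : ∀ i j, i ≠ j → ∀ a ∈ A i, ∀ b ∈ A j, ¬ G.Adj a b) :
    finalExp G (fun F => (F.card : ℝ)) (s.biUnion A)
      = ∑ i ∈ s, finalExp G (fun F => (F.card : ℝ)) (A i) := by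
  induction s using Finset.induction_on with
  | empty =>
    rw [biUnion_empty, sum_empty, finalExp_of_activeSet_eq_empty (by simp [activeSet])]
    simp
  | insert i s hi ih =>
    rw [biUnion_insert, sum_insert hi, ← ih, finalExp_card_union]
    · rw [disjoint_biUnion_right]
      exact fun j hj => hd i j fun e => hi (e ▸ hj)
    · intro a ha b hb
      obtain ⟨j, hj, hbj⟩ := mem_biUnion.mp hb
      exact hadj i j (fun e => hi (e ▸ hj)) a ha b hbj

theorem correctedY_eq_finalExp [Fintype V] (x : V → Bool) :
    correctedY G x = finalExp G (fun F => (F.card : ℝ)) (particles x) := by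
  unfold correctedY
  simp only [correctedCount_eq_finalExp]
  set A : (G.induce {v | x v = true}).ConnectedComponent → Finset V :=
    fun C => (Set.toFinite (Subtype.val '' C.supp)).toFinset with hA
  have hmem : ∀ C v, v ∈ A C ↔ ∃ h : x v = true,
      (G.induce {v | x v = true}).connectedComponentMk ⟨v, h⟩ = C := by
    intro C v
    simp [hA, SimpleGraph.ConnectedComponent.mem_supp_iff]
  refine (finalExp_card_biUnion univ A ?_ ?_).symm.trans ?_
  rotate_left 2
  · congr 1
    ext v
    simp only [mem_biUnion, mem_univ, true_and, hmem, mem_particles]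
    exact ⟨fun ⟨_, h, _⟩ => h, fun h => ⟨_, h, rfl⟩⟩
  · intro C C' hCC
    rw [disjoint_left]
    intro v hv hv'
    obtain ⟨h, rfl⟩ := (hmem _ _).mp hv
    obtain ⟨_, h2⟩ := (hmem _ _).mp hv'
    exact hCC h2
  · intro C C' hCC a ha b hb hab
    obtain ⟨h, rfl⟩ := (hmem _ _).mp ha
    obtain ⟨h', rfl⟩ := (hmem _ _).mp hb
    refine hCC (SimpleGraph.ConnectedComponent.sound (SimpleGraph.Adj.reachable ?_))
    exact hab

end Components

/-! ### One-step drift estimates -/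

section Drift

set_option linter.unusedSectionVars false

variable {V : Type*} [Fintype V] [DecidableEq V] {G : SimpleGraph V} {p : ℝ} {D : ℕ}

theorem card_nbrsIn_le (hD : ∀ v, (nbrsIn G v univ).card ≤ D) (v : V) (S : Finset V) :
    (nbrsIn G v S).card ≤ D :=
  (card_le_card (filter_subset_filter _ (subset_univ S))).trans (hD v)

theorem card_outerBoundary_le (hD : ∀ v, (nbrsIn G v univ).card ≤ D) (S : Finset V) :
    (outerBoundary G S).card ≤ S.card * D := by
  refine (card_le_card (t := S.biUnion fun u => nbrsIn G u univ) fun v hv => ?_).trans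
    (card_biUnion_le_card_mul _ _ _ fun u _ => hD u)
  obtain ⟨-, u, hu, huv⟩ := mem_outerBoundary.mp hv
  exact mem_biUnion.mpr ⟨u, hu, mem_nbrsIn.mpr ⟨mem_univ _, huv.symm⟩⟩

theorem setStep_card_activeSet_le (hD : ∀ v, (nbrsIn G v univ).card ≤ D) (hp0 : 0 ≤ p)
    (hp1 : p ≤ 1) (S : Finset V) :
    setStep G p (fun S => ((activeSet G S).card : ℝ)) S
      ≤ (activeSet G S).card - (1 - p) / Fintype.card V * (activeSet G S).card
        + p / Fintype.card V * (D * (D + 1) * S.card) := by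
  have h1 : ∑ v ∈ activeSet G S, (((activeSet G (S.erase v)).card : ℝ) - (activeSet G S).card)
      ≤ -(activeSet G S).card := by
    have : ∀ v ∈ activeSet G S,
        ((activeSet G (S.erase v)).card : ℝ) - (activeSet G S).card ≤ -1 := fun v hv => by
      have hlt : (activeSet G (S.erase v)).card < (activeSet G S).card := by
        refine card_lt_card ⟨activeSet_mono (erase_subset _ _), fun hsub => ?_⟩
        exact notMem_erase v S (activeSet_subset _ (hsub hv))
      have : ((activeSet G (S.erase v)).card : ℝ) + 1 ≤ (activeSet G S).card := by
        exact_mod_cast hlt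
      linarith
    calc _ ≤ ∑ v ∈ activeSet G S, (-1 : ℝ) := sum_le_sum this
      _ = _ := by simp
  have h2 : ∑ v ∈ outerBoundary G S,
      (((activeSet G (insert v S)).card : ℝ) - (activeSet G S).card)
      ≤ D * (D + 1) * S.card := by
    have : ∀ v ∈ outerBoundary G S,
        ((activeSet G (insert v S)).card : ℝ) - (activeSet G S).card ≤ D + 1 := fun v hv => by
      rw [activeSet_insert (nbrsIn_nonempty_of_mem_outerBoundary hv)]
      have h3 : (insert v (activeSet G S ∪ nbrsIn G v S)).card ≤ (activeSet G S).card + D + 1 :=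
        (card_insert_le _ _).trans (Nat.succ_le_succ ((card_union_le _ _).trans
          (Nat.add_le_add_left (card_nbrsIn_le hD v S) _)))
      have : ((insert v (activeSet G S ∪ nbrsIn G v S)).card : ℝ)
          ≤ (activeSet G S).card + D + 1 := by exact_mod_cast h3
      linarith
    have h4 : ((outerBoundary G S).card : ℝ) ≤ S.card * D := by
      exact_mod_cast card_outerBoundary_le hD S
    calc _ ≤ ∑ v ∈ outerBoundary G S, ((D : ℝ) + 1) := sum_le_sum this
      _ = (outerBoundary G S).card * ((D : ℝ) + 1) := by rw [sum_const, nsmul_eq_mul]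
      _ ≤ S.card * D * (D + 1) := by gcongr
      _ = _ := by ring
  have hq : 0 ≤ (1 - p) / Fintype.card V := div_nonneg (by linarith) (by positivity)
  have hp : 0 ≤ p / Fintype.card V := by positivity
  unfold setStep
  nlinarith [mul_le_mul_of_nonneg_left h1 hq, mul_le_mul_of_nonneg_left h2 hp]

/-- The sum of `U` over ordered pairs of distinct elements of `F`. -/
def pairSum (U : V → V → ℝ) (F : Finset V) : ℝ := ∑ u ∈ F, ∑ w ∈ F.erase u, U u w

/-- The pair interaction per particle, regularized at scale `k`. -/
def pairRatio (U : V → V → ℝ) (k : ℝ) (F : Finset V) : ℝ := pairSum U F / (k + F.card)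

/-- The half increment of `pairRatio` when the particle at `u` moves to `v`. -/
def moveGain (U : V → V → ℝ) (k : ℝ) (u v : V) (F : Finset V) : ℝ :=
  (∑ w ∈ F.erase u, (U v w - U u w)) / (k + F.card)

variable {U : V → V → ℝ} {k ζ θ : ℝ}

theorem pairSum_insert (hsymm : ∀ u v, U u v = U v u) {x : V} {F : Finset V} (hx : x ∉ F) :
    pairSum U (insert x F) = pairSum U F + 2 * ∑ w ∈ F, U x w := by
  unfold pairSum
  rw [sum_insert hx, erase_insert hx]
  have : ∀ u ∈ F, ∑ w ∈ (insert x F).erase u, U u w = U x u + ∑ w ∈ F.erase u, U u w := by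
    intro u hu
    have hxu : x ≠ u := fun e => hx (e ▸ hu)
    rw [erase_insert_of_ne hxu, sum_insert fun h => hx (mem_of_mem_erase h), hsymm u x]
  rw [sum_congr rfl this, sum_add_distrib]
  ring

theorem pairSum_nonneg (hnn : ∀ u v, 0 ≤ U u v) (F : Finset V) : 0 ≤ pairSum U F :=
  sum_nonneg fun _ _ => sum_nonneg fun _ _ => hnn _ _

theorem abs_pairRatio_insert_sub_le (hsymm : ∀ u v, U u v = U v u) (hnn : ∀ u v, 0 ≤ U u v)
    (hk : 0 < k) (hζ : ∀ (F : Finset V) x, ∑ w ∈ F, U x w ≤ ζ * (k + F.card))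
    (F : Finset V) (x : V) (hx : x ∉ F) :
    |pairRatio U k (insert x F) - pairRatio U k F| ≤ 2 * ζ := by
  unfold pairRatio
  rw [pairSum_insert hsymm hx, card_insert_of_notMem hx]
  push_cast
  set m : ℝ := (F.card : ℝ) with hmdef
  have hm : (0 : ℝ) ≤ m := Nat.cast_nonneg _
  have hP0 := pairSum_nonneg hnn F
  have hU0 : 0 ≤ ∑ w ∈ F, U x w := sum_nonneg fun _ _ => hnn _ _
  have hU := hζ F x
  have hP : pairSum U F ≤ m * (ζ * (k + m)) := by
    unfold pairSum
    rw [← nsmul_eq_mul, ← sum_const]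
    refine sum_le_sum fun u _ => (sum_le_sum_of_subset_of_nonneg (erase_subset _ _)
      fun _ _ _ => hnn _ _).trans (hζ F u)
  have hζ0 : 0 ≤ ζ := by
    have := hζ ∅ x
    simp only [sum_empty, card_empty, Nat.cast_zero, add_zero] at this
    exact nonneg_of_mul_nonneg_left this hk
  have hkm : 0 < k + m := by linarith
  have hkm1 : 0 < k + (m + 1) := by linarith
  have e : (pairSum U F + 2 * ∑ w ∈ F, U x w) / (k + (m + 1)) - pairSum U F / (k + m)
      = (2 * (∑ w ∈ F, U x w) * (k + m) - pairSum U F) / ((k + (m + 1)) * (k + m)) := by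
    field_simp
    ring
  rw [e, abs_le, le_div_iff₀ (by positivity), div_le_iff₀ (by positivity)]
  have hζkm : 0 ≤ ζ * (k + m) := by positivity
  constructor
  · nlinarith [mul_nonneg hU0 hkm.le, mul_nonneg hζkm hkm.le, mul_nonneg hζkm hk.le]
  · nlinarith [mul_le_mul_of_nonneg_right hU hkm.le]

theorem pairRatio_move (hsymm : ∀ u v, U u v = U v u) {u v : V} {F : Finset V} (hu : u ∈ F)
    (hv : v ∉ F) :
    pairRatio U k (insert v (F.erase u)) - pairRatio U k F = 2 * moveGain U k u v F := by
  have hv' : v ∉ F.erase u := fun h => hv (mem_of_mem_erase h)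
  have h1 := pairSum_insert hsymm hv'
  have h2 := pairSum_insert hsymm (notMem_erase u F)
  rw [insert_erase hu] at h2
  unfold pairRatio moveGain
  rw [card_insert_of_notMem hv', card_erase_add_one hu, h1, h2, sum_sub_distrib]
  ring

theorem abs_moveGain_le (hnn : ∀ u v, 0 ≤ U u v)
    (hk : 0 < k) (hζ : ∀ (F : Finset V) x, ∑ w ∈ F, U x w ≤ ζ * (k + F.card))
    (u v : V) (F : Finset V) : |moveGain U k u v F| ≤ ζ := by
  have hkm : 0 < k + F.card := by positivity
  have h : ∀ x, ∑ w ∈ F.erase u, U x w ≤ ζ * (k + F.card) := fun x =>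
    (sum_le_sum_of_subset_of_nonneg (erase_subset _ _) fun _ _ _ => hnn _ _).trans (hζ F x)
  have h0 : ∀ x, 0 ≤ ∑ w ∈ F.erase u, U x w := fun x => sum_nonneg fun _ _ => hnn _ _
  unfold moveGain
  rw [abs_div, abs_of_pos hkm, div_le_iff₀ hkm, sum_sub_distrib, abs_le]
  constructor <;> linarith [h u, h v, h0 u, h0 v]

/-- The total move gain of moves of particles of `F` to `v`. -/
def moveGainTo (G : SimpleGraph V) (U : V → V → ℝ) (k : ℝ) (v : V) (F : Finset V) : ℝ :=
  ∑ u ∈ nbrsIn G v F, moveGain U k u v F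

theorem abs_moveGainTo_le (hD : ∀ v, (nbrsIn G v univ).card ≤ D) (hnn : ∀ u v, 0 ≤ U u v)
    (hk : 0 < k) (hζ0 : 0 ≤ ζ) (hζ : ∀ (F : Finset V) x, ∑ w ∈ F, U x w ≤ ζ * (k + F.card))
    (v : V) (F : Finset V) : |moveGainTo G U k v F| ≤ D * ζ := by
  calc |moveGainTo G U k v F| ≤ ∑ u ∈ nbrsIn G v F, |moveGain U k u v F| := abs_sum_le_sum_abs _ _
    _ ≤ ∑ u ∈ nbrsIn G v F, ζ := sum_le_sum fun u _ => abs_moveGain_le hnn hk hζ u v F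
    _ = (nbrsIn G v F).card * ζ := by simp
    _ ≤ D * ζ := by
      gcongr
      exact card_nbrsIn_le hD v F

/-- The Lyapunov function on final sets. -/
def energy (U : V → V → ℝ) (k θ : ℝ) (F : Finset V) : ℝ := F.card - θ * pairRatio U k F

theorem abs_energy_insert_sub_le (hsymm : ∀ u v, U u v = U v u) (hnn : ∀ u v, 0 ≤ U u v)
    (hk : 0 < k) (hζ : ∀ (F : Finset V) x, ∑ w ∈ F, U x w ≤ ζ * (k + F.card)) (hθ : 0 ≤ θ)
    (F : Finset V) (x : V) (hx : x ∉ F) :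
    |energy U k θ (insert x F) - energy U k θ F| ≤ 1 + θ * (2 * ζ) := by
  have h := mul_le_mul_of_nonneg_left (abs_pairRatio_insert_sub_le hsymm hnn hk hζ F x hx) hθ
  rw [← abs_of_nonneg hθ, ← abs_mul, abs_of_nonneg hθ, abs_le] at h
  unfold energy
  rw [card_insert_of_notMem hx, abs_le]
  push_cast
  constructor <;> linarith [h.1, h.2]

theorem finalExp_energy (S : Finset V) : finalExp G (energy U k θ) S
    = finalExp G (fun F => (F.card : ℝ)) S - θ * finalExp G (pairRatio U k) S := by
  unfold energy
  rw [finalExp_sub, finalExp_const_mul]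

theorem finalExp_energy_insert_sub_add_le (hD : ∀ v, (nbrsIn G v univ).card ≤ D)
    (hsymm : ∀ u v, U u v = U v u) (hnn : ∀ u v, 0 ≤ U u v) (hk : 0 < k) (hζ0 : 0 ≤ ζ)
    (hζ : ∀ (F : Finset V) x, ∑ w ∈ F, U x w ≤ ζ * (k + F.card)) (hθ : 0 ≤ θ)
    (hsmall : θ * ζ * (D + 1) ≤ 1 / 6) {S : Finset V} {v : V} (hv : v ∈ outerBoundary G S) :
    finalExp G (energy U k θ) (insert v S) - finalExp G (energy U k θ) S
        + θ * finalExp G (moveGainTo G U k v) S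
      ≤ if Disjoint (nbrsIn G v S) (activeSet G S) then 0 else 2 * ((D : ℝ) + 1) := by
  have hvS := (mem_outerBoundary.mp hv).1
  have hne := nbrsIn_nonempty_of_mem_outerBoundary hv
  have hdeg : ((nbrsIn G v S).card : ℝ) ≤ D := by exact_mod_cast card_nbrsIn_le hD v S
  have hgain : finalExp G (moveGainTo G U k v) S ≤ D * ζ := by
    conv_rhs => rw [← finalExp_const (G := G) (D * ζ) S]
    exact finalExp_mono _ fun F _ _ => (abs_le.mp (abs_moveGainTo_le hD hnn hk hζ0 hζ v F)).2
  have hgainθ := mul_le_mul_of_nonneg_left hgain hθ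
  have hD0 : (0 : ℝ) ≤ D := Nat.cast_nonneg _
  have hθζ : 0 ≤ θ * ζ := by positivity
  split_ifs with hdis
  · by_cases h2 : 2 ≤ (nbrsIn G v S).card
    · have h3 := finalExp_card_insert_le hvS hdis hne
      rw [if_pos h2] at h3
      have h4 := abs_finalExp_insert_sub_le (G := G)
        (abs_pairRatio_insert_sub_le hsymm hnn hk hζ) v S hvS
      have h5 : (1 + ((nbrsIn G v S).card : ℝ)) * (2 * ζ) ≤ (1 + D) * (2 * ζ) := by gcongr
      have h6 := mul_le_mul_of_nonneg_left ((abs_le.mp h4).1) hθ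
      have h7 := mul_le_mul_of_nonneg_left h5 hθ
      rw [finalExp_energy, finalExp_energy]
      nlinarith
    · obtain ⟨u, hu⟩ := card_eq_one.mp (le_antisymm (by omega) (card_pos.mpr hne))
      have huN : u ∈ nbrsIn G v S := by rw [hu]; exact mem_singleton_self _
      obtain ⟨huS, huv⟩ := mem_nbrsIn.mp huN
      have huA := disjoint_left.mp hdis huN
      rw [finalExp_insert_of_nbrsIn_eq_singleton _ hvS huA hu]
      have h3 : finalExp G (fun F => energy U k θ (insert v (F.erase u))) S
          = finalExp G (energy U k θ) S - 2 * (θ * finalExp G (moveGainTo G U k v) S) := by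
        rw [← mul_assoc, ← finalExp_const_mul, ← finalExp_sub]
        refine finalExp_congr _ fun F hF hF' => ?_
        have huF : u ∈ F := hF' (mem_sdiff.mpr ⟨huS, huA⟩)
        have hvF : v ∉ F := fun h => hvS (hF h)
        have hN : nbrsIn G v F = {u} := by
          refine Subset.antisymm ?_ (singleton_subset_iff.mpr (mem_nbrsIn.mpr ⟨huF, huv⟩))
          rw [← hu]
          exact filter_subset_filter _ hF
        have h4 := pairRatio_move (k := k) hsymm huF hvF
        have h5 : moveGainTo G U k v F = moveGain U k u v F := by
          rw [moveGainTo, hN, sum_singleton]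
        unfold energy
        rw [card_insert_of_notMem fun h => hvF (mem_of_mem_erase h), card_erase_add_one huF, h5]
        linear_combination -θ * h4
      rw [h3]
      linarith
  · have h4 := (abs_le.mp (abs_finalExp_insert_sub_le (G := G)
      (abs_energy_insert_sub_le hsymm hnn hk hζ hθ) v S hvS)).2
    have h5 : (1 + ((nbrsIn G v S).card : ℝ)) * (1 + θ * (2 * ζ))
        ≤ (1 + D) * (1 + θ * (2 * ζ)) := by gcongr
    nlinarith

theorem sum_finalExp_energy_insert_sub_add_le (hD : ∀ v, (nbrsIn G v univ).card ≤ D)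
    (hsymm : ∀ u v, U u v = U v u) (hnn : ∀ u v, 0 ≤ U u v) (hk : 0 < k) (hζ0 : 0 ≤ ζ)
    (hζ : ∀ (F : Finset V) x, ∑ w ∈ F, U x w ≤ ζ * (k + F.card)) (hθ : 0 ≤ θ)
    (hsmall : θ * ζ * (D + 1) ≤ 1 / 6) (S : Finset V) :
    ∑ v ∈ outerBoundary G S, (finalExp G (energy U k θ) (insert v S)
        - finalExp G (energy U k θ) S)
        + θ * finalExp G (fun F => ∑ v, moveGainTo G U k v F) S
      ≤ (2 * (D + 1) * D + 1) * (activeSet G S).card := by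
  have hD0 : (0 : ℝ) ≤ D := Nat.cast_nonneg _
  have hdisj : Disjoint (outerBoundary G S) (activeSet G S) := by
    rw [disjoint_left]
    exact fun v hv hv' => (mem_outerBoundary.mp hv).1 (activeSet_subset S hv')
  have hzero : ∀ v ∉ outerBoundary G S ∪ activeSet G S,
      finalExp G (moveGainTo G U k v) S = 0 := by
    intro v hv
    rw [← finalExp_const (G := G) 0 S]
    refine finalExp_congr _ fun F hF _ => ?_
    rw [moveGainTo]
    refine sum_eq_zero fun u hu => ?_
    obtain ⟨huF, huv⟩ := mem_nbrsIn.mp hu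
    rw [mem_union, mem_outerBoundary, mem_activeSet, ← or_and_right] at hv
    exact (hv ⟨(Classical.em (v ∈ S)).symm, u, hF huF, huv⟩).elim
  rw [finalExp_sum, ← sum_subset (subset_univ (outerBoundary G S ∪ activeSet G S))
    fun v _ hv => hzero v hv, sum_union hdisj, mul_add, ← add_assoc, mul_sum, ← sum_add_distrib]
  have h1 := sum_le_sum fun v (hv : v ∈ outerBoundary G S) =>
    finalExp_energy_insert_sub_add_le hD hsymm hnn hk hζ0 hζ hθ hsmall hv
  have h2 : ∑ v ∈ outerBoundary G S,
      (if Disjoint (nbrsIn G v S) (activeSet G S) then 0 else 2 * ((D : ℝ) + 1))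
      ≤ 2 * (D + 1) * D * (activeSet G S).card := by
    rw [sum_ite, sum_const_zero, zero_add, sum_const, nsmul_eq_mul]
    have : ((outerBoundary G S).filter
        fun v => ¬ Disjoint (nbrsIn G v S) (activeSet G S)).card ≤ (activeSet G S).card * D := by
      refine (card_le_card (t := (activeSet G S).biUnion fun u => nbrsIn G u univ)
        fun v hv => ?_).trans (card_biUnion_le_card_mul _ _ _ fun u _ => hD u)
      obtain ⟨u, hu, hu'⟩ := not_disjoint_iff.mp (mem_filter.mp hv).2
      exact mem_biUnion.mpr ⟨u, hu', mem_nbrsIn.mpr ⟨mem_univ _, (mem_nbrsIn.mp hu).2.symm⟩⟩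
    have : (((outerBoundary G S).filter
        fun v => ¬ Disjoint (nbrsIn G v S) (activeSet G S)).card : ℝ)
        ≤ (activeSet G S).card * D := by exact_mod_cast this
    nlinarith
  have h3 : θ * ∑ v ∈ activeSet G S, finalExp G (moveGainTo G U k v) S
      ≤ (activeSet G S).card := by
    rw [mul_sum, Finset.card_eq_sum_ones, Nat.cast_sum]
    refine sum_le_sum fun v _ => ?_
    have hgain : finalExp G (moveGainTo G U k v) S ≤ D * ζ := by
      conv_rhs => rw [← finalExp_const (G := G) (D * ζ) S]
      exact finalExp_mono _ fun F _ _ => (abs_le.mp (abs_moveGainTo_le hD hnn hk hζ0 hζ v F)).2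
    have := mul_le_mul_of_nonneg_left hgain hθ
    have : 0 ≤ θ * ζ := by positivity
    push_cast
    nlinarith
  linarith

theorem finalExp_energy_succ {U' : V → V → ℝ} {a : ℝ}
    (hrec : ∀ u w, u ≠ w → U' u w = U u w + a * ∑ v ∈ nbrsIn G u univ, (U v w - U u w))
    (S : Finset V) :
    finalExp G (energy U k θ) S = finalExp G (energy U' k θ) S
      + a * (θ * finalExp G (fun F => ∑ v, moveGainTo G U k v F) S) := by
  rw [← mul_assoc, ← finalExp_const_mul, ← finalExp_add]
  congr 1
  funext F
  have h1 : pairSum U' F = pairSum U F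
      + a * ∑ u ∈ F, ∑ v ∈ nbrsIn G u univ, ∑ w ∈ F.erase u, (U v w - U u w) := by
    unfold pairSum
    rw [mul_sum, ← sum_add_distrib]
    refine sum_congr rfl fun u _ => ?_
    rw [sum_comm, mul_sum, ← sum_add_distrib]
    exact sum_congr rfl fun w hw => hrec u w (mem_erase.mp hw).1.symm
  have h2 : ∑ v, moveGainTo G U k v F
      = (∑ u ∈ F, ∑ v ∈ nbrsIn G u univ, ∑ w ∈ F.erase u, (U v w - U u w)) / (k + F.card) := by
    unfold moveGainTo moveGain
    rw [sum_div, sum_comm' (t' := F) (s' := fun u => nbrsIn G u univ)]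
    · exact sum_congr rfl fun u _ => (sum_div _ _ _).symm
    · intro v u
      simp only [mem_univ, true_and, mem_nbrsIn, SimpleGraph.adj_comm]
      tauto
  unfold energy pairRatio
  rw [h1, h2]
  ring

theorem setStep_finalExp (f : Finset V → ℝ) (S : Finset V) :
    setStep G p (finalExp G f) S = finalExp G f S
      + p / Fintype.card V * ∑ v ∈ outerBoundary G S, (finalExp G f (insert v S)
        - finalExp G f S) := by
  rw [setStep, sum_finalExp_erase_sub, mul_zero, add_zero]

end Drift

/-! ### The Lyapunov iteration -/

section Iteration

set_option linter.unusedSectionVars false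

variable {V : Type*} [Fintype V] [DecidableEq V] {G : SimpleGraph V} {p : ℝ} {D : ℕ}
  {k ζ θ b δ : ℝ}

/-- The Lyapunov function on particle sets: the expected energy of the final set, corrected by a
multiple of the number of active vertices. -/
def lyapunov (G : SimpleGraph V) (U : V → V → ℝ) (k θ b : ℝ) (S : Finset V) : ℝ :=
  finalExp G (energy U k θ) S + b * (activeSet G S).card

/-- The expected number of final vertices plus a multiple of the number of active vertices. -/
def massBound (G : SimpleGraph V) (b : ℝ) (S : Finset V) : ℝ :=
  finalExp G (fun F => (F.card : ℝ)) S + b * (activeSet G S).card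

theorem finalExp_card_nonneg (S : Finset V) : 0 ≤ finalExp G (fun F => (F.card : ℝ)) S := by
  rw [← finalExp_const (G := G) 0 S]
  exact finalExp_mono _ fun F _ _ => Nat.cast_nonneg _

theorem finalExp_card_le (S : Finset V) :
    finalExp G (fun F => (F.card : ℝ)) S ≤ Fintype.card V := by
  rw [← finalExp_const (G := G) (Fintype.card V : ℝ) S]
  exact finalExp_mono _ fun F _ _ => by exact_mod_cast card_le_univ F

theorem setStep_lyapunov_le {U U' : V → V → ℝ} (hD : ∀ v, (nbrsIn G v univ).card ≤ D)
    (hp0 : 0 ≤ p) (hp1 : p ≤ 1) (hb0 : 0 ≤ b)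
    (hb : p * (2 * (D + 1) * D + 1 + b * (D * (D + 1))) ≤ b * (1 - p))
    (hδ : δ = p / Fintype.card V * (b * (D * (D + 1))))
    (hsymm : ∀ u v, U u v = U v u) (hnn : ∀ u v, 0 ≤ U u v) (hk : 0 < k) (hζ0 : 0 ≤ ζ)
    (hζ : ∀ (F : Finset V) x, ∑ w ∈ F, U x w ≤ ζ * (k + F.card)) (hθ : 0 ≤ θ)
    (hsmall : θ * ζ * (D + 1) ≤ 1 / 6)
    (hrec : ∀ u w, u ≠ w →
      U' u w = U u w + p / Fintype.card V * ∑ v ∈ nbrsIn G u univ, (U v w - U u w))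
    (S : Finset V) :
    setStep G p (lyapunov G U k θ b) S
      ≤ lyapunov G U' k θ b S + δ * finalExp G (fun F => (F.card : ℝ)) S := by
  have h0 : setStep G p (lyapunov G U k θ b) S = setStep G p (finalExp G (energy U k θ)) S
      + b * setStep G p (fun S => ((activeSet G S).card : ℝ)) S := by
    rw [← setStep_const_mul, ← setStep_add]
    rfl
  have ha : 0 ≤ p / Fintype.card V := by positivity
  have h1 := mul_le_mul_of_nonneg_left
    (sum_finalExp_energy_insert_sub_add_le hD hsymm hnn hk hζ0 hζ hθ hsmall S) ha
  have h2 := mul_le_mul_of_nonneg_left (setStep_card_activeSet_le hD hp0 hp1 S) hb0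
  have h3 := mul_le_mul_of_nonneg_left (card_le_activeSet_add_finalExp (G := G) S)
    (show 0 ≤ p / Fintype.card V * (b * (D * (D + 1))) by positivity)
  have h4 := finalExp_energy_succ (G := G) (k := k) (θ := θ) hrec S
  have h5 := mul_le_mul_of_nonneg_right hb
    (show 0 ≤ ((activeSet G S).card : ℝ) / Fintype.card V by positivity)
  rw [h0, setStep_finalExp, lyapunov, hδ]
  have e1 : p / Fintype.card V * ((2 * (D + 1) * D + 1) * ((activeSet G S).card : ℝ))
      + p / Fintype.card V * (b * (D * (D + 1))) * (activeSet G S).card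
      = p * (2 * (D + 1) * D + 1 + b * (D * (D + 1)))
        * (((activeSet G S).card : ℝ) / Fintype.card V) := by ring
  have e2 : b * (1 - p) * (((activeSet G S).card : ℝ) / Fintype.card V)
      = b * ((1 - p) / Fintype.card V * (activeSet G S).card) := by ring
  linarith

theorem lyapunov_zero (S : Finset V) :
    lyapunov G (fun _ _ => 0) k θ b S = massBound G b S := by
  have : energy (fun _ _ => 0) k θ = fun F : Finset V => (F.card : ℝ) := by
    funext F
    simp [energy, pairRatio, pairSum]
  rw [lyapunov, massBound, this]

theorem setStep_massBound_le (hD : ∀ v, (nbrsIn G v univ).card ≤ D)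
    (hp0 : 0 ≤ p) (hp1 : p ≤ 1) (hb0 : 0 ≤ b)
    (hb : p * (2 * (D + 1) * D + 1 + b * (D * (D + 1))) ≤ b * (1 - p))
    (hδ : δ = p / Fintype.card V * (b * (D * (D + 1)))) (S : Finset V) :
    setStep G p (massBound G b) S ≤ (1 + δ) * massBound G b S := by
  have hδ0 : 0 ≤ δ := by rw [hδ]; positivity
  have h := setStep_lyapunov_le (U := fun _ _ => 0) (U' := fun _ _ => 0) (k := 1) (ζ := 0)
    (θ := 0) hD hp0 hp1 hb0 hb hδ (fun _ _ => rfl) (fun _ _ => le_rfl) one_pos le_rfl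
    (by simp) le_rfl (by norm_num) (by simp) S
  rw [lyapunov_zero, funext fun S => lyapunov_zero (G := G) (k := 1) (θ := 0) (b := b) S] at h
  have : δ * finalExp G (fun F => (F.card : ℝ)) S ≤ δ * massBound G b S := by
    gcongr
    rw [massBound]
    have : 0 ≤ b * ((activeSet G S).card : ℝ) := by positivity
    linarith
  linarith

theorem iterate_massBound_le (hD : ∀ v, (nbrsIn G v univ).card ≤ D)
    (hp0 : 0 ≤ p) (hp1 : p ≤ 1) (hb0 : 0 ≤ b)
    (hb : p * (2 * (D + 1) * D + 1 + b * (D * (D + 1))) ≤ b * (1 - p))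
    (hδ : δ = p / Fintype.card V * (b * (D * (D + 1)))) (t : ℕ) (S : Finset V) :
    (setStep G p)^[t] (massBound G b) S ≤ (1 + δ) ^ t * massBound G b S := by
  have hδ0 : 0 ≤ δ := by rw [hδ]; positivity
  induction t generalizing S with
  | zero => simp
  | succ t ih =>
    rw [Function.iterate_succ_apply']
    refine (setStep_mono hp0 hp1 ih S).trans ?_
    rw [setStep_const_mul, pow_succ, mul_assoc]
    gcongr
    exact setStep_massBound_le hD hp0 hp1 hb0 hb hδ S

theorem iterate_lyapunov_le {U : ℕ → V → V → ℝ} {R : ℕ} (hD : ∀ v, (nbrsIn G v univ).card ≤ D)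
    (hp0 : 0 ≤ p) (hp1 : p ≤ 1) (hb0 : 0 ≤ b)
    (hb : p * (2 * (D + 1) * D + 1 + b * (D * (D + 1))) ≤ b * (1 - p))
    (hδ : δ = p / Fintype.card V * (b * (D * (D + 1))))
    (hzero : ∀ u v, U 0 u v = 0)
    (hsymm : ∀ r u v, U r u v = U r v u) (hnn : ∀ r u v, 0 ≤ U r u v) (hk : 0 < k) (hζ0 : 0 ≤ ζ)
    (hζ : ∀ r ≤ R, ∀ (F : Finset V) x, ∑ w ∈ F, U r x w ≤ ζ * (k + F.card)) (hθ : 0 ≤ θ)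
    (hsmall : θ * ζ * (D + 1) ≤ 1 / 6)
    (hrec : ∀ r u w, u ≠ w →
      U (r + 1) u w = U r u w + p / Fintype.card V * ∑ v ∈ nbrsIn G u univ, (U r v w - U r u w))
    {r : ℕ} (hr : r ≤ R) (S : Finset V) :
    (setStep G p)^[r] (massBound G b) S
      ≤ lyapunov G (U r) k θ b S + δ * r * (1 + δ) ^ r * massBound G b S := by
  have hδ0 : 0 ≤ δ := by rw [hδ]; positivity
  have hM0 : ∀ S, 0 ≤ massBound G b S := fun S =>
    add_nonneg (finalExp_card_nonneg S) (by positivity)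
  induction r generalizing S with
  | zero =>
    have : U 0 = fun _ _ => 0 := by funext u v; exact hzero u v
    simp [this, lyapunov_zero]
  | succ r ih =>
    rw [Function.iterate_succ_apply']
    refine (setStep_mono hp0 hp1 (ih (by omega)) S).trans ?_
    rw [setStep_add, setStep_const_mul]
    have h1 := setStep_lyapunov_le hD hp0 hp1 hb0 hb hδ (hsymm r) (hnn r) hk hζ0
      (hζ r (by omega)) hθ hsmall (hrec r) S
    have h2 := mul_le_mul_of_nonneg_left (setStep_massBound_le hD hp0 hp1 hb0 hb hδ S)
      (show 0 ≤ δ * r * (1 + δ) ^ r by positivity)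
    have h3 : δ * finalExp G (fun F => (F.card : ℝ)) S ≤ δ * (1 + δ) ^ (r + 1) * massBound G b S := by
      rw [mul_assoc]
      gcongr
      have h4 : finalExp G (fun F => (F.card : ℝ)) S ≤ massBound G b S := by
        rw [massBound]
        have : 0 ≤ b * ((activeSet G S).card : ℝ) := by positivity
        linarith
      exact h4.trans (le_mul_of_one_le_left (hM0 S) (one_le_pow₀ (by linarith)))
    have e : δ * ((r + 1 : ℕ) : ℝ) * (1 + δ) ^ (r + 1) * massBound G b S
        = δ * r * (1 + δ) ^ r * ((1 + δ) * massBound G b S)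
          + δ * (1 + δ) ^ (r + 1) * massBound G b S := by
      push_cast
      ring
    linarith

theorem finalExp_energy_le {U : V → V → ℝ} {ρ d : ℝ} (hθ : 0 ≤ θ) (hρ : 0 ≤ ρ) (hd : 0 ≤ d)
    (hpos : ∀ F : Finset V, ρ * (F.card : ℝ) ^ 2 ≤ ∑ u ∈ F, ∑ w ∈ F, U u w)
    (hdiag : ∀ u, U u u ≤ d) {S : Finset V}
    (hkS : finalExp G (fun F => (F.card : ℝ)) S = k) (hk : 0 < k) :
    finalExp G (energy U k θ) S ≤ k - θ * (ρ * (k / 2) - d) := by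
  have h : ∀ F : Finset V, ρ * (k / 2 - 3 / 4 * k) - d + ρ * (3 / 4) * (F.card : ℝ)
      ≤ pairRatio U k F := by
    intro F
    have h1 : pairSum U F = ∑ u ∈ F, ∑ w ∈ F, U u w - ∑ u ∈ F, U u u := by
      unfold pairSum
      rw [← sum_sub_distrib]
      exact sum_congr rfl fun u hu => by rw [← add_sum_erase F _ hu]; ring
    have h2 : ∑ u ∈ F, U u u ≤ F.card * d := by
      rw [← nsmul_eq_mul, ← sum_const]
      exact sum_le_sum fun u _ => hdiag u
    have h3 := hpos F
    have hm : (0 : ℝ) ≤ F.card := Nat.cast_nonneg _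
    unfold pairRatio
    rw [le_div_iff₀ (by linarith), h1]
    nlinarith [mul_nonneg hρ (sq_nonneg ((F.card : ℝ) - k)), mul_nonneg hd hk.le]
  have h5 := finalExp_mono (G := G) S fun F _ _ => h F
  rw [finalExp_add, finalExp_const, finalExp_const_mul, hkS] at h5
  rw [finalExp_energy, hkS]
  nlinarith

end Iteration

/-! ### Growth bound from an interaction kernel -/

section Core

set_option maxHeartbeats 2000000 in
theorem exists_iterate_setStep_le {c T g : ℝ} (hc : 0 < c) (hg : 0 ≤ g) (D : ℕ) (q : ℝ → ℝ) :
    ∃ C : ℝ, ∃ N : ℕ, ∀ {V : Type} [Fintype V] [DecidableEq V] (G : SimpleGraph V),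
      N < Fintype.card V → (∀ v, (nbrsIn G v univ).card ≤ D) →
      ∀ U : ℕ → V → V → ℝ,
      (∀ u v, U 0 u v = 0) → (∀ r u v, U r u v = U r v u) → (∀ r u v, 0 ≤ U r u v) →
      (∀ r u w, u ≠ w → U (r + 1) u w = U r u w
        + c / (Fintype.card V : ℝ) ^ 2 * ∑ v ∈ nbrsIn G u univ, (U r v w - U r u w)) →
      (∀ r, ∀ F : Finset V, c * r / (Fintype.card V : ℝ) ^ 3 * (F.card : ℝ) ^ 2
        ≤ ∑ u ∈ F, ∑ w ∈ F, U r u w) →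
      (∀ η, 0 < η → ∀ r, ∀ F : Finset V, ∀ x, ∑ w ∈ F, U r x w
        ≤ (g * (c * r / (Fintype.card V : ℝ) ^ 3) + η) * F.card + q η) →
      ∀ (s : ℕ) (S : Finset V), (s : ℝ) ≤ T * (Fintype.card V : ℝ) ^ 3 →
        (setStep G (c / Fintype.card V))^[s] (finalExp G fun F => (F.card : ℝ)) S
          ≤ finalExp G (fun F => (F.card : ℝ)) S + C := by
  set β : ℝ := 4 * c * (2 * (D + 1) * D + 1) with hβ
  set C₁ : ℝ := c * β * (D * (D + 1)) with hC₁
  set θ : ℝ := (24 * C₁ + 4) / c with hθdef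
  set d : ℝ := 2 + |q 1| with hd
  set A : ℝ := 1 + θ * d + 4 * β with hA
  set ζ : ℝ := 1 / (6 * θ * (D + 1)) with hζ
  set K : ℝ := 1 + C₁ * A + g * c * A + 3 * (g * c * A) / ζ + 3 * |q (ζ / 3)| / ζ with hK
  have hβ0 : 0 < β := by positivity
  have hC0 : 0 ≤ C₁ := by positivity
  have hθ0 : 0 < θ := by positivity
  have hd0 : 0 < d := by positivity
  have hA0 : 1 ≤ A := by
    have : 0 ≤ θ * d := by positivity
    linarith
  have hζ0 : 0 < ζ := by positivity
  have hKt : 0 ≤ C₁ * A ∧ 0 ≤ g * c * A ∧ 0 ≤ 3 * (g * c * A) / ζ ∧ 0 ≤ 3 * |q (ζ / 3)| / ζ := by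
    refine ⟨?_, ?_, ?_, ?_⟩ <;> positivity
  obtain ⟨hK1, hK2, hK3, hK4⟩ := hKt
  obtain ⟨N, hN⟩ := exists_nat_gt (4 * c * (D * (D + 1)) + 2 * c)
  refine ⟨Real.exp (C₁ * T) * (K + β) + (4 * β + 3 * (C₁ * A)), N, ?_⟩
  intro V _ _ G hcard hD U hzero hsymm hnn hrec hpos hpot
  set n : ℝ := (Fintype.card V : ℝ) with hn
  have hNn : (N : ℝ) < n := by rw [hn]; exact_mod_cast hcard
  have hn4 : 4 * c * (D * (D + 1)) ≤ n := by
    have : 0 ≤ 2 * c := by positivity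
    linarith
  have hn2 : 2 * c ≤ n := by
    have : 0 ≤ 4 * c * ((D : ℝ) * (D + 1)) := by positivity
    linarith
  have hn1 : 1 ≤ n := by
    have : 0 < Fintype.card V := by omega
    rw [hn]
    exact_mod_cast this
  have hn0 : 0 < n := by linarith
  set p : ℝ := c / n with hp
  have hp0 : 0 ≤ p := by positivity
  have hp2 : p ≤ 1 / 2 := by
    rw [hp, div_le_iff₀ hn0]
    linarith
  have hp1 : p ≤ 1 := by linarith
  set b : ℝ := β / n with hb
  have hb0 : 0 ≤ b := by positivity
  set δ : ℝ := p / n * (b * (D * (D + 1))) with hδ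
  have hδ' : δ = C₁ / n ^ 3 := by
    rw [hδ, hp, hb, hC₁]
    field_simp
  have hδ0 : 0 ≤ δ := by positivity
  have hbc : p * (2 * (D + 1) * D + 1 + b * (D * (D + 1))) ≤ b * (1 - p) := by
    have h1 : b * (1 / 2) ≤ b * (1 - p) := by gcongr; linarith
    refine le_trans ?_ h1
    have h2 : p * (2 * (D + 1) * D + 1 + b * (D * (D + 1)))
        = (β / 4 + β * (c * (D * (D + 1)) / n)) / n := by
      rw [hp, hb, hβ]
      field_simp
    have h3 : c * (D * (D + 1)) / n ≤ 1 / 4 := by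
      rw [div_le_iff₀ hn0]
      linarith
    rw [h2, hb, div_mul_eq_mul_div]
    gcongr
    nlinarith
  have hW : ∀ S, b * ((activeSet G S).card : ℝ) ≤ β := fun S => by
    have : ((activeSet G S).card : ℝ) ≤ n := by rw [hn]; exact_mod_cast card_le_univ (activeSet G S)
    calc b * ((activeSet G S).card : ℝ) ≤ b * n := by gcongr
      _ = β := by rw [hb]; field_simp
  have hW0 : ∀ S, 0 ≤ b * ((activeSet G S).card : ℝ) := fun S => by positivity
  have hlow : ∀ (s : ℕ) S, (setStep G p)^[s] (finalExp G fun F => (F.card : ℝ)) S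
      ≤ (setStep G p)^[s] (massBound G b) S := fun s S =>
    iterate_setStep_mono hp0 hp1 (fun S => by
      have := hW0 S
      rw [massBound]
      linarith) s S
  have hpow : ∀ s : ℕ, (1 + δ) ^ s ≤ Real.exp (δ * s) := fun s => by
    rw [mul_comm, Real.exp_nat_mul]
    gcongr
    linarith [Real.add_one_le_exp δ]
  have hexp1 : Real.exp 1 ≤ 3 := Real.exp_one_lt_three.le
  -- the remainder accumulated over a time interval on which `δ * s` is at most `C₁ * A / k`
  have hrem : ∀ (s : ℕ) S, K < finalExp G (fun F => (F.card : ℝ)) S →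
      δ * s ≤ C₁ * A / finalExp G (fun F => (F.card : ℝ)) S →
      δ * s * (1 + δ) ^ s * massBound G b S ≤ 3 * (C₁ * A) + 3 * β := by
    intro s S hkK hs
    set k := finalExp G (fun F => (F.card : ℝ)) S with hk
    have hk0 : 0 < k := by linarith
    have h1 : C₁ * A / k ≤ 1 := by
      rw [div_le_one hk0]
      linarith
    have h2 : (1 + δ) ^ s ≤ 3 :=
      (hpow s).trans ((Real.exp_le_exp.mpr (hs.trans h1)).trans hexp1)
    have h3 : massBound G b S ≤ k + β := by
      rw [massBound]
      linarith [hW S]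
    have h4 : 0 ≤ massBound G b S := by
      rw [massBound]
      linarith [hW0 S]
    calc δ * s * (1 + δ) ^ s * massBound G b S ≤ C₁ * A / k * 3 * (k + β) := by gcongr
      _ = 3 * (C₁ * A) + C₁ * A / k * (3 * β) := by field_simp
      _ ≤ 3 * (C₁ * A) + 1 * (3 * β) := by gcongr
      _ = _ := by ring
  intro s
  induction s using Nat.strong_induction_on with
  | _ s ih =>
  intro S hsT
  set k := finalExp G (fun F => (F.card : ℝ)) S with hk
  have hk0 : 0 ≤ k := finalExp_card_nonneg S
  by_cases hkK : k ≤ K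
  · have h1 := (hlow s S).trans (iterate_massBound_le hD hp0 hp1 hb0 hbc rfl s S)
    have h2 : (1 + δ) ^ s ≤ Real.exp (C₁ * T) := by
      refine (hpow s).trans (Real.exp_le_exp.mpr ?_)
      rw [hδ']
      calc C₁ / n ^ 3 * s ≤ C₁ / n ^ 3 * (T * n ^ 3) := by gcongr
        _ = C₁ * T := by field_simp
    have h3 : massBound G b S ≤ K + β := by
      rw [massBound]
      linarith [hW S]
    have h4 : 0 ≤ massBound G b S := by
      rw [massBound]
      linarith [hW0 S]
    have h5 : (1 + δ) ^ s * massBound G b S ≤ Real.exp (C₁ * T) * (K + β) := by gcongr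
    have : 0 ≤ 4 * β + 3 * (C₁ * A) := by positivity
    linarith
  push Not at hkK
  have hk0 : 0 < k := by linarith
  have hkn : k ≤ n := finalExp_card_le S
  set s₁ : ℕ := ⌊A * n ^ 3 / k⌋₊ with hs₁
  have hx0 : 0 ≤ A * n ^ 3 / k := by positivity
  have hx1 : 1 ≤ A * n ^ 3 / k := by
    rw [le_div_iff₀ hk0]
    nlinarith [mul_le_mul hA0 (le_self_pow₀ hn1 (by norm_num : 3 ≠ 0)) hn0.le (by linarith)]
  have hs₁le : (s₁ : ℝ) ≤ A * n ^ 3 / k := Nat.floor_le hx0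
  have hs₁ge : A * n ^ 3 / k / 2 ≤ s₁ := by
    have h1 : A * n ^ 3 / k < s₁ + 1 := Nat.lt_floor_add_one _
    have h2 : (1 : ℝ) ≤ s₁ := by
      exact_mod_cast Nat.le_floor (show ((1 : ℕ) : ℝ) ≤ _ by simpa using hx1)
    linarith
  have hδs : ∀ r ≤ s₁, δ * r ≤ C₁ * A / k := by
    intro r hr
    have : (r : ℝ) ≤ s₁ := by exact_mod_cast hr
    rw [hδ']
    calc C₁ / n ^ 3 * r ≤ C₁ / n ^ 3 * (A * n ^ 3 / k) := by gcongr; linarith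
      _ = _ := by field_simp
  have hexpK : 0 ≤ Real.exp (C₁ * T) * (K + β) := by positivity
  rcases le_or_gt s s₁ with hs | hs
  · have h1 := iterate_lyapunov_le (U := fun _ _ _ => 0) (k := 1) (θ := 0) (ζ := 0) (R := s)
      hD hp0 hp1 hb0 hbc rfl (fun _ _ => rfl) (fun _ _ _ => rfl) (fun _ _ _ => le_rfl) one_pos
      le_rfl (by simp) le_rfl (by norm_num) (by simp) le_rfl S
    rw [lyapunov_zero] at h1
    have h2 := hrem s S hkK (hδs s hs)
    have h3 := hlow s S
    have h4 : massBound G b S ≤ k + β := by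
      rw [massBound]
      linarith [hW S]
    linarith
  · have hkey : (setStep G p)^[s₁] (finalExp G fun F => (F.card : ℝ)) S ≤ k := by
      have hck : ∀ r ≤ s₁, c * r / n ^ 3 ≤ c * A / k := by
        intro r hr
        have : (r : ℝ) ≤ s₁ := by exact_mod_cast hr
        calc c * r / n ^ 3 ≤ c * (A * n ^ 3 / k) / n ^ 3 := by gcongr; linarith
          _ = _ := by field_simp
      have hζF : ∀ r ≤ s₁, ∀ (F : Finset V) x, ∑ w ∈ F, U r x w ≤ ζ * (k + F.card) := by
        intro r hr F x
        refine (hpot (ζ / 3) (by positivity) r F x).trans ?_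
        have h1 : g * (c * r / n ^ 3) ≤ ζ / 3 := by
          calc g * (c * r / n ^ 3) ≤ g * (c * A / k) := 
              mul_le_mul_of_nonneg_left (hck r hr) hg
            _ = g * c * A / k := by ring
            _ ≤ ζ / 3 := by
              rw [div_le_iff₀ hk0]
              have : 3 * (g * c * A) / ζ ≤ k := by linarith
              rw [div_le_iff₀ hζ0] at this
              linarith
        have h2 : q (ζ / 3) ≤ ζ / 3 * k := by
          have : 3 * |q (ζ / 3)| / ζ ≤ k := by linarith
          rw [div_le_iff₀ hζ0] at this
          linarith [le_abs_self (q (ζ / 3))]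
        have hm : (0 : ℝ) ≤ F.card := Nat.cast_nonneg _
        have h3 := mul_le_mul_of_nonneg_right h1 hm
        nlinarith [mul_nonneg hζ0.le hm, mul_nonneg hζ0.le hk0.le]
      have hsmall : θ * ζ * (D + 1) ≤ 1 / 6 := by
        rw [hζ]
        apply le_of_eq
        field_simp
      have hdiag : ∀ u, U s₁ u u ≤ d := by
        intro u
        have h1 := hpot 1 one_pos s₁ {u} u
        simp only [sum_singleton, card_singleton, Nat.cast_one, mul_one] at h1
        have h2 : g * (c * s₁ / n ^ 3) ≤ 1 := by
          calc g * (c * s₁ / n ^ 3) ≤ g * (c * A / k) := 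
              mul_le_mul_of_nonneg_left (hck s₁ le_rfl) hg
            _ = g * c * A / k := by ring
            _ ≤ 1 := by
              rw [div_le_one hk0]
              linarith
        linarith [le_abs_self (q 1)]
      have h1 := iterate_lyapunov_le (U := U) (R := s₁) hD hp0 hp1 hb0 hbc rfl hzero hsymm hnn hk0
        hζ0.le hζF hθ0.le hsmall (fun r u w huw => by
          rw [hrec r u w huw, hp, ← hn, div_div, ← pow_two]) le_rfl S
      have h2 := hrem s₁ S hkK (hδs s₁ le_rfl)
      have h3 := finalExp_energy_le (G := G) hθ0.le (show 0 ≤ c * s₁ / n ^ 3 by positivity)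
        hd0.le (hpos s₁) hdiag hk.symm hk0
      have h4 : c * A / 4 ≤ c * s₁ / n ^ 3 * (k / 2) := by
        calc c * A / 4 = c * (A * n ^ 3 / k / 2) / n ^ 3 * (k / 2) := by
              field_simp
              norm_num
          _ ≤ _ := by gcongr
      have h5 : θ * (c * A / 4) ≤ θ * (c * s₁ / n ^ 3 * (k / 2)) := by gcongr
      have h6 : θ * (c * A / 4) = 6 * (C₁ * A) + A := by
        rw [hθdef]
        field_simp
        ring
      have h7 := hlow s₁ S
      have h8 := hW S
      rw [lyapunov] at h1
      linarith
    have hs₁pos : 0 < s₁ := Nat.floor_pos.mpr hx1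
    have hsub : s₁ + (s - s₁) = s := by omega
    rw [← hsub, Function.iterate_add_apply]
    have h1 : ∀ S, (setStep G p)^[s - s₁] (finalExp G fun F => (F.card : ℝ)) S
        ≤ finalExp G (fun F => (F.card : ℝ)) S
          + (Real.exp (C₁ * T) * (K + β) + (4 * β + 3 * (C₁ * A))) := fun S =>
      ih (s - s₁) (by omega) S (le_trans (by exact_mod_cast Nat.sub_le s s₁) hsT)
    refine (iterate_setStep_mono hp0 hp1 h1 s₁ S).trans ?_
    rw [iterate_setStep_add_const]
    linarith

end Core

/-! ### The return probability on a cycle -/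

section Cycle

variable {ℓ : ℕ} [NeZero ℓ]

theorem sum_zmod_val (f : ℕ → ℝ) : ∑ x : ZMod ℓ, f x.val = ∑ m ∈ range ℓ, f m := by
  refine sum_nbij ZMod.val (fun x _ => mem_range.mpr (ZMod.val_lt x))
    (fun x _ y _ h => ZMod.val_injective ℓ h) (fun m hm => ?_) fun _ _ => rfl
  exact ⟨(m : ZMod ℓ), mem_coe.mpr (mem_univ _),
    ZMod.val_natCast_of_lt (mem_range.mp (mem_coe.mp hm))⟩

theorem re_stdAddChar (x : ZMod ℓ) :
    (ZMod.stdAddChar x : ℂ).re = Real.cos (2 * Real.pi * x.val / ℓ) := by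
  rw [ZMod.stdAddChar_apply, ZMod.toCircle_apply]
  have : 2 * (Real.pi : ℂ) * Complex.I * x.val / ℓ
      = ((2 * Real.pi * x.val / ℓ : ℝ) : ℂ) * Complex.I := by push_cast; ring
  rw [this, Complex.exp_ofReal_mul_I_re]

theorem le_two_sub_two_mul_cos {m : ℝ} (hm : 0 ≤ m) (hmℓ : 2 * m ≤ ℓ) :
    16 * (m / ℓ) ^ 2 ≤ 2 - 2 * Real.cos (2 * Real.pi * m / ℓ) := by
  have hℓ : (0 : ℝ) < ℓ := by exact_mod_cast NeZero.pos ℓ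
  have h1 : 2 / Real.pi * (Real.pi * m / ℓ) ≤ Real.sin (Real.pi * m / ℓ) := by
    refine Real.mul_le_sin (by positivity) ?_
    rw [div_le_div_iff₀ hℓ two_pos]
    nlinarith [Real.pi_pos]
  have h2 : 2 / Real.pi * (Real.pi * m / ℓ) = 2 * (m / ℓ) := by
    field_simp
  have h3 : Real.cos (2 * Real.pi * m / ℓ) = 1 - 2 * Real.sin (Real.pi * m / ℓ) ^ 2 := by
    rw [show 2 * Real.pi * m / ℓ = 2 * (Real.pi * m / ℓ) by ring, Real.cos_two_mul]
    linarith [Real.sin_sq_add_cos_sq (Real.pi * m / ℓ)]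
  rw [h2] at h1
  rw [h3]
  have : 0 ≤ m / ℓ := by positivity
  nlinarith

theorem exp_neg_mul_symbol_le {b : ℝ} (hb : 0 ≤ b) {m : ℕ} (hm : m ≤ ℓ) :
    Real.exp (-(b * (2 - 2 * Real.cos (2 * Real.pi * m / ℓ))))
      ≤ Real.exp (-(b * (16 * ((m : ℝ) / ℓ) ^ 2)))
        + Real.exp (-(b * (16 * (((ℓ - m : ℕ) : ℝ) / ℓ) ^ 2))) := by
  have hℓ : (0 : ℝ) < ℓ := by exact_mod_cast NeZero.pos ℓ
  rcases le_total (2 * m) ℓ with h | h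
  · have h1 : 2 * (m : ℝ) ≤ ℓ := by exact_mod_cast h
    refine le_add_of_le_of_nonneg (Real.exp_le_exp.mpr (neg_le_neg ?_)) (Real.exp_pos _).le
    exact mul_le_mul_of_nonneg_left (le_two_sub_two_mul_cos (Nat.cast_nonneg _) h1) hb
  · have h1 : 2 * (((ℓ - m : ℕ)) : ℝ) ≤ ℓ := by
      exact_mod_cast (show 2 * (ℓ - m) ≤ ℓ by omega)
    refine le_add_of_nonneg_of_le (Real.exp_pos _).le (Real.exp_le_exp.mpr (neg_le_neg ?_))
    have h2 : Real.cos (2 * Real.pi * m / ℓ)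
        = Real.cos (2 * Real.pi * ((ℓ - m : ℕ) : ℝ) / ℓ) := by
      rw [← Real.cos_two_pi_sub]
      congr 1
      rw [Nat.cast_sub hm]
      field_simp
    rw [h2]
    exact mul_le_mul_of_nonneg_left (le_two_sub_two_mul_cos (Nat.cast_nonneg _) h1) hb

theorem sum_range_exp_neg_sq_le {t : ℝ} (ht : 0 < t) (M : ℕ) :
    ∑ m ∈ range M, Real.exp (-(t * m) ^ 2) ≤ 3 * (1 + 1 / (2 * t)) := by
  set x := Real.exp (-(2 * t)) with hx
  have hx0 : 0 < x := Real.exp_pos _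
  have hx1 : x * (1 + 2 * t) ≤ 1 := by
    have h1 : x * Real.exp (2 * t) = 1 := by rw [hx, ← Real.exp_add]; simp
    have h2 := Real.add_one_le_exp (2 * t)
    nlinarith
  have hxlt : 0 < 1 - x := by nlinarith
  have h1 : ∀ m : ℕ, Real.exp (-(t * m) ^ 2) ≤ 3 * x ^ m := fun m => by
    have : Real.exp (-(t * m) ^ 2) ≤ Real.exp 1 * x ^ m := by
      rw [hx, ← Real.exp_nat_mul, ← Real.exp_add, Real.exp_le_exp]
      nlinarith [sq_nonneg (t * m - 1)]
    refine this.trans ?_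
    gcongr
    exact Real.exp_one_lt_three.le
  have h2 : ∑ m ∈ range M, x ^ m ≤ 1 + 1 / (2 * t) := by
    have h3 := geom_sum_mul_neg x M
    have h4 : 1 ≤ (1 + 1 / (2 * t)) * (1 - x) := by
      rw [show (1 + 1 / (2 * t)) * (1 - x) = 1 + (1 - x * (1 + 2 * t)) / (2 * t) by
        field_simp; ring]
      have : 0 ≤ (1 - x * (1 + 2 * t)) / (2 * t) := div_nonneg (by linarith) (by positivity)
      linarith
    refine le_of_mul_le_mul_right ?_ hxlt
    rw [h3]
    have : 0 ≤ x ^ M := by positivity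
    linarith
  calc _ ≤ ∑ m ∈ range M, 3 * x ^ m := sum_le_sum fun m _ => h1 m
    _ = 3 * ∑ m ∈ range M, x ^ m := by rw [mul_sum]
    _ ≤ _ := by gcongr

theorem sum_exp_neg_symbol_le {b : ℝ} (hb : 0 < b) :
    (∑ x : ZMod ℓ, Real.exp (-(b * (2 - 2 * (ZMod.stdAddChar x : ℂ).re)))) / ℓ
      ≤ 12 * (1 / ℓ + 1 / √b) := by
  have hℓ : (0 : ℝ) < ℓ := by exact_mod_cast NeZero.pos ℓ
  have hs : 0 < √b := Real.sqrt_pos.mpr hb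
  set t := 4 * √b / ℓ with ht
  have ht0 : 0 < t := by positivity
  have hsq : ∀ m : ℕ, -(b * (16 * ((m : ℝ) / ℓ) ^ 2)) = -(t * m) ^ 2 := fun m => by
    rw [ht]
    nth_rewrite 1 [← Real.sq_sqrt hb.le]
    ring
  have h1 : ∑ x : ZMod ℓ, Real.exp (-(b * (2 - 2 * (ZMod.stdAddChar x : ℂ).re)))
      ≤ ∑ m ∈ range (ℓ + 1), Real.exp (-(t * m) ^ 2)
        + ∑ m ∈ range (ℓ + 1), Real.exp (-(t * m) ^ 2) := by
    simp only [re_stdAddChar]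
    rw [sum_zmod_val fun m => Real.exp (-(b * (2 - 2 * Real.cos (2 * Real.pi * m / ℓ))))]
    nth_rewrite 3 [← sum_range_reflect]
    rw [← sum_add_distrib]
    refine (sum_le_sum_of_subset_of_nonneg (range_mono (Nat.le_succ ℓ))
      fun _ _ _ => (Real.exp_pos _).le).trans (sum_le_sum fun m hm => ?_)
    have := exp_neg_mul_symbol_le (ℓ := ℓ) hb.le (Nat.lt_succ_iff.mp (mem_range.mp hm))
    rw [hsq, hsq] at this
    simpa using this
  have h2 := sum_range_exp_neg_sq_le ht0 (ℓ + 1)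
  rw [div_le_iff₀ hℓ]
  have h3 : 1 / (2 * t) * 8 = ℓ * (1 / √b) := by
    rw [ht]
    field_simp
    norm_num
  have h4 : 12 * (1 / ℓ + 1 / √b) * ℓ = 12 + 12 * (ℓ * (1 / √b)) := by
    field_simp
  have h5 : 0 ≤ 1 / (2 * t) := by positivity
  rw [h4]
  linarith

end Cycle

/-! ### Summation over time -/

section TimeSums

theorem div_sqrt_cube_le {a t : ℝ} (ha : 0 < a) (hat : a ≤ t) :
    a * (1 / √t) ^ 3 ≤ 6 * (1 / √t - 1 / √(t + a)) := by
  have ht : 0 < t := ha.trans_le hat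
  set x := √t with hx
  set y := √(t + a) with hy
  have hx0 : 0 < x := Real.sqrt_pos.mpr ht
  have hy0 : 0 < y := Real.sqrt_pos.mpr (by linarith)
  have hx2 : x ^ 2 = t := Real.sq_sqrt ht.le
  have hy2 : y ^ 2 = t + a := Real.sq_sqrt (by linarith)
  have ha' : a = (y - x) * (y + x) := by nlinarith
  have hxy : x ≤ y := Real.sqrt_le_sqrt (by linarith)
  have hy3 : y ≤ 3 / 2 * x := by
    refine abs_le_of_sq_le_sq' ?_ (by positivity) |>.2
    nlinarith
  have e : 6 * (1 / x - 1 / y) = 6 * (y - x) / (x * y) := by field_simp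
  have e' : a * (1 / x) ^ 3 = (y - x) * (y + x) / x ^ 3 := by rw [← ha']; field_simp
  rw [e, e', div_le_div_iff₀ (by positivity) (by positivity)]
  have h1 : (y + x) * y ≤ 6 * x ^ 2 := by nlinarith
  have h2 := mul_le_mul_of_nonneg_left h1 (mul_nonneg (sub_nonneg.mpr hxy) hx0.le)
  nlinarith

theorem sum_div_sqrt_cube_le {a τ : ℝ} (ha : 0 < a) (haτ : a ≤ τ) (r : ℕ) :
    a * ∑ j ∈ range r, (if a * j < τ then 0 else (1 / √(a * j)) ^ 3) ≤ 6 / √τ := by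
  have hτ : 0 < τ := ha.trans_le haτ
  have key : a * ∑ j ∈ range r, (if a * j < τ then 0 else (1 / √(a * j)) ^ 3)
      ≤ 6 * (1 / √τ - 1 / √(max τ (a * r))) := by
    induction r with
    | zero => simp [max_eq_left hτ.le]
    | succ r ih =>
      rw [sum_range_succ, mul_add]
      have e : a * ((r + 1 : ℕ) : ℝ) = a * r + a := by push_cast; ring
      rw [e]
      split_ifs with h
      · have h1 : 1 / √(max τ (a * r + a)) ≤ 1 / √(max τ (a * r)) := by
          apply one_div_le_one_div_of_le
          · exact Real.sqrt_pos.mpr (lt_max_of_lt_left hτ)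
          · exact Real.sqrt_le_sqrt (max_le_max le_rfl (by linarith))
        linarith
      · push Not at h
        rw [max_eq_right (by linarith)]
        rw [max_eq_right h] at ih
        have := div_sqrt_cube_le ha (haτ.trans h)
        linarith
  have h0 : 0 ≤ 1 / √(max τ (a * r)) := by positivity
  have : 6 * (1 / √τ) = 6 / √τ := by ring
  linarith

theorem sum_indicator_le {a τ : ℝ} (ha : 0 ≤ a) (hτ : 0 ≤ τ) (r : ℕ) :
    a * ∑ j ∈ range r, (if a * j < τ then (1 : ℝ) else 0) ≤ τ + a := by
  have key : a * ∑ j ∈ range r, (if a * j < τ then (1 : ℝ) else 0) ≤ a * r ∧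
      a * ∑ j ∈ range r, (if a * j < τ then (1 : ℝ) else 0) ≤ τ + a := by
    induction r with
    | zero => simp; linarith
    | succ r ih =>
      obtain ⟨h1, h2⟩ := ih
      rw [sum_range_succ, mul_add]
      push_cast
      split_ifs with h
      · exact ⟨by linarith, by linarith⟩
      · exact ⟨by linarith, by linarith⟩
  exact key.2

end TimeSums

/-! ### The heat kernel on the torus -/

section Heat

variable {ℓ d : ℕ} [NeZero ℓ] {a : ℝ}

/-- The character of the torus with frequency `ξ`. -/
def character (ξ z : Fin d → ZMod ℓ) : ℂ := ∏ i, ZMod.stdAddChar (ξ i * z i)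

/-- The Fourier symbol of the graph Laplacian of the torus. -/
def symbol (ξ : Fin d → ZMod ℓ) : ℝ := ∑ i, (2 - 2 * (ZMod.stdAddChar (ξ i) : ℂ).re)

/-- The transition probabilities of the lazy simple random walk with rate `a` per edge. -/
def heat (a : ℝ) (j : ℕ) (z : Fin d → ZMod ℓ) : ℝ :=
  (∑ ξ, (1 - a * symbol ξ) ^ j * (character ξ z).re) / (ℓ : ℝ) ^ d

theorem abs_re_stdAddChar_le (x : ZMod ℓ) : |(ZMod.stdAddChar x : ℂ).re| ≤ 1 :=
  (Complex.abs_re_le_norm _).trans (AddChar.norm_apply _ _).le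

theorem symbol_le (ξ : Fin d → ZMod ℓ) : symbol ξ ≤ 4 * d := by
  calc symbol ξ ≤ ∑ _i : Fin d, (4 : ℝ) :=
        sum_le_sum fun i _ => by linarith [(abs_le.mp (abs_re_stdAddChar_le (ξ i))).1]
    _ = 4 * d := by simp [mul_comm]

theorem one_sub_symbol_nonneg (ha : 0 ≤ a) (had : 4 * d * a ≤ 1) (ξ : Fin d → ZMod ℓ) :
    0 ≤ 1 - a * symbol ξ := by
  nlinarith [mul_le_mul_of_nonneg_left (symbol_le ξ) ha]

theorem character_add (ξ z w : Fin d → ZMod ℓ) :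
    character ξ (z + w) = character ξ z * character ξ w := by
  simp only [character, Pi.add_apply, mul_add, AddChar.map_add_eq_mul, prod_mul_distrib]

theorem character_neg (ξ z : Fin d → ZMod ℓ) :
    character ξ (-z) = starRingEnd ℂ (character ξ z) := by
  simp only [character, Pi.neg_apply, mul_neg, AddChar.map_neg_eq_conj, map_prod]

theorem character_zero (ξ : Fin d → ZMod ℓ) : character ξ 0 = 1 := by
  simp [character]

theorem zero_character (z : Fin d → ZMod ℓ) : character 0 z = 1 := by
  simp [character]

theorem norm_character (ξ z : Fin d → ZMod ℓ) : ‖character ξ z‖ = 1 := by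
  simp [character, AddChar.norm_apply]

theorem character_single (ξ : Fin d → ZMod ℓ) (i : Fin d) :
    character ξ (Pi.single i 1) = ZMod.stdAddChar (ξ i) := by
  rw [character, prod_eq_single i]
  · simp
  · intro j _ hj
    simp [Pi.single_eq_of_ne hj]
  · simp

theorem sum_character (z : Fin d → ZMod ℓ) :
    ∑ ξ, character ξ z = if z = 0 then (ℓ : ℂ) ^ d else 0 := by
  have h := prod_univ_sum (fun _ : Fin d => (univ : Finset (ZMod ℓ)))
    fun i x => (ZMod.stdAddChar (x * z i) : ℂ)
  rw [Fintype.piFinset_univ] at h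
  unfold character
  rw [← h]
  simp only [AddChar.sum_mulShift _ (ZMod.isPrimitive_stdAddChar ℓ), ZMod.card]
  split_ifs with hz
  · simp [hz]
  · obtain ⟨i, hi⟩ := Function.ne_iff.mp hz
    exact prod_eq_zero (mem_univ i) (by rw [if_neg (by simpa using hi), Nat.cast_zero])

theorem heat_zero (z : Fin d → ZMod ℓ) : heat a 0 z = if z = 0 then 1 else 0 := by
  have hℓ : (ℓ : ℝ) ^ d ≠ 0 := pow_ne_zero _ (by exact_mod_cast NeZero.ne ℓ)
  unfold heat
  simp only [pow_zero, one_mul]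
  rw [← Complex.re_sum, sum_character]
  split_ifs
  · rw [div_eq_one_iff_eq hℓ]
    norm_cast
  · simp

theorem character_re_add_add_sub (ξ z : Fin d → ZMod ℓ) (i : Fin d) :
    (character ξ (z + Pi.single i 1)).re + (character ξ (z - Pi.single i 1)).re
      = 2 * (ZMod.stdAddChar (ξ i) : ℂ).re * (character ξ z).re := by
  rw [sub_eq_add_neg, character_add, character_add, character_neg, character_single]
  simp only [Complex.mul_re, Complex.conj_re, Complex.conj_im]
  ring

theorem heat_succ (j : ℕ) (z : Fin d → ZMod ℓ) :
    heat a (j + 1) z = heat a j z + a * ∑ i, (heat a j (z + Pi.single i 1)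
      + heat a j (z - Pi.single i 1) - 2 * heat a j z) := by
  have h : ∑ i, (heat a j (z + Pi.single i 1) + heat a j (z - Pi.single i 1) - 2 * heat a j z)
      = (∑ ξ, (1 - a * symbol ξ) ^ j * (-symbol ξ * (character ξ z).re)) / (ℓ : ℝ) ^ d := by
    unfold heat
    have : ∀ i : Fin d, (∑ ξ, (1 - a * symbol ξ) ^ j * (character ξ (z + Pi.single i 1)).re)
          / (ℓ : ℝ) ^ d
        + (∑ ξ, (1 - a * symbol ξ) ^ j * (character ξ (z - Pi.single i 1)).re) / (ℓ : ℝ) ^ d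
        - 2 * ((∑ ξ, (1 - a * symbol ξ) ^ j * (character ξ z).re) / (ℓ : ℝ) ^ d)
        = (∑ ξ, (1 - a * symbol ξ) ^ j *
          (-(2 - 2 * (ZMod.stdAddChar (ξ i) : ℂ).re) * (character ξ z).re)) / (ℓ : ℝ) ^ d := by
      intro i
      rw [← mul_div_assoc, ← add_div, ← sub_div, mul_sum, ← sum_add_distrib, ← sum_sub_distrib]
      congr 1
      refine sum_congr rfl fun ξ _ => ?_
      linear_combination (1 - a * symbol ξ) ^ j * character_re_add_add_sub ξ z i
    rw [sum_congr rfl fun i _ => this i, ← sum_div, sum_comm]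
    congr 1
    refine sum_congr rfl fun ξ _ => ?_
    rw [← mul_sum, ← sum_mul, sum_neg_distrib]
    rfl
  rw [h]
  unfold heat
  rw [← mul_div_assoc, ← add_div, mul_sum, ← sum_add_distrib]
  congr 1
  refine sum_congr rfl fun ξ _ => ?_
  rw [pow_succ]
  ring

theorem heat_neg (j : ℕ) (z : Fin d → ZMod ℓ) : heat a j (-z) = heat a j z := by
  simp only [heat, character_neg, Complex.conj_re]

theorem heat_nonneg (ha : 0 ≤ a) (had : 4 * d * a ≤ 1) (j : ℕ) (z : Fin d → ZMod ℓ) :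
    0 ≤ heat a j z := by
  induction j generalizing z with
  | zero =>
    rw [heat_zero]
    split_ifs <;> norm_num
  | succ j ih =>
    have e : heat a (j + 1) z = (1 - 2 * d * a) * heat a j z
        + a * ∑ i : Fin d, (heat a j (z + Pi.single i 1) + heat a j (z - Pi.single i 1)) := by
      rw [heat_succ, sum_sub_distrib, sum_const, card_univ, Fintype.card_fin, nsmul_eq_mul]
      ring
    rw [e]
    have hd : 0 ≤ (d : ℝ) * a := by positivity
    refine add_nonneg (mul_nonneg (by linarith) (ih z)) (mul_nonneg ha ?_)
    exact sum_nonneg fun i _ => add_nonneg (ih _) (ih _)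

theorem sum_heat (j : ℕ) : ∑ z : Fin d → ZMod ℓ, heat a j z = 1 := by
  induction j with
  | zero => simp [heat_zero]
  | succ j ih =>
    have h1 : ∀ v : Fin d → ZMod ℓ, ∑ z, heat a j (z + v) = 1 := fun v => by
      rw [← ih]
      exact Equiv.sum_comp (Equiv.addRight v) (heat a j)
    have h2 : ∀ v : Fin d → ZMod ℓ, ∑ z, heat a j (z - v) = 1 := fun v => by
      rw [← ih]
      exact Equiv.sum_comp (Equiv.subRight v) (heat a j)
    simp only [heat_succ]
    rw [sum_add_distrib, ih, ← mul_sum, sum_comm]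
    simp only [sum_sub_distrib, sum_add_distrib, h1, h2, ← mul_sum, ih]
    simp only [sum_const, card_univ, Fintype.card_fin, nsmul_eq_mul]
    ring

theorem heat_le_heat_zero (ha : 0 ≤ a) (had : 4 * d * a ≤ 1) (j : ℕ) (z : Fin d → ZMod ℓ) :
    heat a j z ≤ heat a j (0 : Fin d → ZMod ℓ) := by
  unfold heat
  refine div_le_div_of_nonneg_right (sum_le_sum fun ξ _ => mul_le_mul_of_nonneg_left ?_
    (pow_nonneg (one_sub_symbol_nonneg ha had ξ) j)) (by positivity)
  rw [character_zero, Complex.one_re]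
  exact (le_abs_self _).trans ((Complex.abs_re_le_norm _).trans (norm_character ξ z).le)

theorem sum_sum_re_character_nonneg (ξ : Fin d → ZMod ℓ) (F : Finset (Fin d → ZMod ℓ)) :
    0 ≤ ∑ u ∈ F, ∑ w ∈ F, (character ξ (u - w)).re := by
  have : ∑ u ∈ F, ∑ w ∈ F, (character ξ (u - w)).re
      = ((∑ u ∈ F, character ξ u) * starRingEnd ℂ (∑ u ∈ F, character ξ u)).re := by
    rw [map_sum, sum_mul_sum, Complex.re_sum]
    refine sum_congr rfl fun u _ => ?_
    rw [Complex.re_sum]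
    refine sum_congr rfl fun w _ => ?_
    rw [sub_eq_add_neg, character_add, character_neg]
  rw [this, Complex.mul_conj, Complex.ofReal_re]
  exact Complex.normSq_nonneg _

theorem card_sq_div_le_sum_heat (ha : 0 ≤ a) (had : 4 * d * a ≤ 1) (j : ℕ)
    (F : Finset (Fin d → ZMod ℓ)) :
    (F.card : ℝ) ^ 2 / (ℓ : ℝ) ^ d ≤ ∑ u ∈ F, ∑ w ∈ F, heat a j (u - w) := by
  have e : ∑ u ∈ F, ∑ w ∈ F, heat a j (u - w)
      = (∑ ξ, (1 - a * symbol ξ) ^ j * ∑ u ∈ F, ∑ w ∈ F, (character ξ (u - w)).re)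
        / (ℓ : ℝ) ^ d := by
    simp only [heat, mul_sum, sum_div]
    symm
    rw [sum_comm]
    exact sum_congr rfl fun u _ => sum_comm
  rw [e]
  gcongr
  have h0 : (F.card : ℝ) ^ 2 = (1 - a * symbol (0 : Fin d → ZMod ℓ)) ^ j
      * ∑ u ∈ F, ∑ w ∈ F, (character 0 (u - w)).re := by
    simp [symbol, zero_character, pow_two]
  rw [h0]
  exact single_le_sum (f := fun ξ : Fin d → ZMod ℓ => (1 - a * symbol ξ) ^ j
      * ∑ u ∈ F, ∑ w ∈ F, (character ξ (u - w)).re)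
    (fun ξ _ => mul_nonneg (pow_nonneg (one_sub_symbol_nonneg ha had ξ) j)
      (sum_sum_re_character_nonneg ξ F)) (mem_univ 0)

theorem heat_zero_le (ha : 0 ≤ a) (had : 4 * d * a ≤ 1) (hd : 3 ≤ d) (j : ℕ) (hj : 1 ≤ a * j) :
    heat a j (0 : Fin d → ZMod ℓ)
      ≤ 24 ^ d * (1 / (ℓ : ℝ) ^ d + (1 / √(a * j)) ^ 3) := by
  have hℓ : (0 : ℝ) < ℓ := by exact_mod_cast NeZero.pos ℓ
  have h1 : heat a j (0 : Fin d → ZMod ℓ)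
      ≤ ((∑ x : ZMod ℓ, Real.exp (-(a * j * (2 - 2 * (ZMod.stdAddChar x : ℂ).re)))) / ℓ) ^ d := by
    have h2 := prod_univ_sum (fun _ : Fin d => (univ : Finset (ZMod ℓ)))
      fun _ x => Real.exp (-(a * j * (2 - 2 * (ZMod.stdAddChar x : ℂ).re)))
    rw [Fintype.piFinset_univ, prod_const, card_univ, Fintype.card_fin] at h2
    unfold heat
    rw [div_pow, h2]
    gcongr with ξ
    rw [character_zero, Complex.one_re, mul_one, ← Real.exp_sum, sum_neg_distrib, ← mul_sum]
    have h3 : 1 - a * symbol ξ ≤ Real.exp (-(a * symbol ξ)) := by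
      linarith [Real.add_one_le_exp (-(a * symbol ξ))]
    calc (1 - a * symbol ξ) ^ j ≤ Real.exp (-(a * symbol ξ)) ^ j :=
          pow_le_pow_left₀ (one_sub_symbol_nonneg ha had ξ) h3 j
      _ = _ := by
        rw [← Real.exp_nat_mul, symbol]
        congr 1
        ring
  have hs1 : 1 ≤ √(a * j) := by
    rw [Real.one_le_sqrt]
    exact hj
  have hs0 : 0 < √(a * j) := by linarith
  calc heat a j (0 : Fin d → ZMod ℓ) ≤ _ := h1
    _ ≤ (12 * (1 / ℓ + 1 / √(a * j))) ^ d := by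
      gcongr
      exact sum_exp_neg_symbol_le (by linarith)
    _ = 12 ^ d * (1 / ℓ + 1 / √(a * j)) ^ d := mul_pow _ _ _
    _ ≤ 12 ^ d * (2 ^ d * ((1 / ℓ) ^ d + (1 / √(a * j)) ^ d)) := by
      gcongr
      refine (add_pow_le (by positivity) (by positivity) d).trans ?_
      gcongr
      · norm_num
      · omega
    _ = 24 ^ d * (1 / (ℓ : ℝ) ^ d + (1 / √(a * j)) ^ d) := by
      rw [← mul_assoc, ← mul_pow, one_div_pow]
      norm_num
    _ ≤ _ := by
      gcongr 24 ^ d * (1 / (ℓ : ℝ) ^ d + ?_)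
      exact pow_le_pow_of_le_one (by positivity) (by rw [div_le_one hs0]; exact hs1) hd

theorem sum_heat_sub_le (ha : 0 < a) (ha1 : a ≤ 1) (had : 4 * d * a ≤ 1) (hd : 3 ≤ d) {τ : ℝ}
    (hτ : 1 ≤ τ) (r : ℕ) (F : Finset (Fin d → ZMod ℓ)) (x : Fin d → ZMod ℓ) :
    ∑ w ∈ F, a * ∑ j ∈ range r, heat a j (x - w)
      ≤ (24 ^ d * (a * r / (ℓ : ℝ) ^ d) + 24 ^ d * (6 / √τ)) * F.card + (τ + 1) := by
  have h1 : ∀ j : ℕ, ∑ w ∈ F, heat a j (x - w) ≤ (if a * j < τ then (1 : ℝ) else 0)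
      + F.card * (24 ^ d * (1 / (ℓ : ℝ) ^ d + if a * j < τ then 0 else (1 / √(a * j)) ^ 3)) := by
    intro j
    split_ifs with h
    · refine le_add_of_le_of_nonneg ?_ (by positivity)
      rw [← sum_heat (ℓ := ℓ) (d := d) (a := a) j,
        ← Equiv.sum_comp (Equiv.subLeft x) (heat a j)]
      exact sum_le_sum_of_subset_of_nonneg (subset_univ F) fun w _ _ => heat_nonneg ha.le had j _
    · push Not at h
      rw [zero_add, ← nsmul_eq_mul, ← sum_const]
      exact sum_le_sum fun w _ => (heat_le_heat_zero ha.le had j _).trans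
        (heat_zero_le ha.le had hd j (hτ.trans h))
  have h2 := sum_indicator_le ha.le (show 0 ≤ τ by linarith) r
  have h3 := sum_div_sqrt_cube_le ha (ha1.trans hτ) r
  calc ∑ w ∈ F, a * ∑ j ∈ range r, heat a j (x - w)
      = a * ∑ j ∈ range r, ∑ w ∈ F, heat a j (x - w) := by rw [← mul_sum, sum_comm]
    _ ≤ a * ∑ j ∈ range r, ((if a * j < τ then (1 : ℝ) else 0)
      + F.card * (24 ^ d * (1 / (ℓ : ℝ) ^ d
        + if a * j < τ then 0 else (1 / √(a * j)) ^ 3))) := by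
      gcongr with j
      exact h1 j
    _ = a * ∑ j ∈ range r, (if a * j < τ then (1 : ℝ) else 0)
      + F.card * (24 ^ d * (a * r / (ℓ : ℝ) ^ d
        + a * ∑ j ∈ range r, if a * j < τ then 0 else (1 / √(a * j)) ^ 3)) := by
      rw [sum_add_distrib, ← mul_sum, ← mul_sum, sum_add_distrib, sum_const, card_range,
        nsmul_eq_mul]
      ring
    _ ≤ (τ + a) + F.card * (24 ^ d * (a * r / (ℓ : ℝ) ^ d + 6 / √τ)) := by gcongr
    _ ≤ (τ + 1) + F.card * (24 ^ d * (a * r / (ℓ : ℝ) ^ d + 6 / √τ)) := by gcongr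
    _ = _ := by ring

end Heat

/-! ### The torus -/

section Torus

theorem torusGraph_adj {ℓ d : ℕ} {u v : Fin d → ZMod ℓ} (hℓ : 3 ≤ ℓ) :
    (torusGraph ℓ d).Adj v u ↔ (∃ i, u + Pi.single i 1 = v) ∨ ∃ i, u - Pi.single i 1 = v := by
  have : Fact (1 < ℓ) := ⟨by omega⟩
  have hsingle : ∀ i : Fin d, (fun j => if j = i then (1 : ZMod ℓ) else 0) = Pi.single i 1 := by
    intro i
    funext j
    simp [Pi.single_apply]
  rw [torusGraph, SimpleGraph.fromRel_adj]
  simp only [hsingle]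
  constructor
  · rintro ⟨-, ⟨i, hi⟩ | ⟨i, hi⟩⟩
    · exact Or.inr ⟨i, by rw [hi]; abel⟩
    · exact Or.inl ⟨i, hi.symm⟩
  · rintro (⟨i, rfl⟩ | ⟨i, rfl⟩)
    · exact ⟨by simp, Or.inr ⟨i, rfl⟩⟩
    · exact ⟨by simp, Or.inl ⟨i, by abel⟩⟩

theorem sum_nbrsIn_torusGraph {ℓ d : ℕ} [NeZero ℓ] (hℓ : 3 ≤ ℓ) (u : Fin d → ZMod ℓ)
    (f : (Fin d → ZMod ℓ) → ℝ) :
    ∑ v ∈ nbrsIn (torusGraph ℓ d) u univ, f v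
      = ∑ i, (f (u + Pi.single i 1) + f (u - Pi.single i 1)) := by
  have : Fact (1 < ℓ) := ⟨by omega⟩
  have htwo : (1 : ZMod ℓ) ≠ -1 := fun h => by
    have h2 : ((2 : ℕ) : ZMod ℓ) = 0 := by
      push_cast
      linear_combination h
    rw [ZMod.natCast_eq_zero_iff] at h2
    exact absurd (Nat.le_of_dvd two_pos h2) (by omega)
  have hinj : Function.Injective fun i : Fin d => (Pi.single i 1 : Fin d → ZMod ℓ) := by
    intro i k h
    by_contra hik
    have := congrFun h i
    simp [Pi.single_eq_of_ne hik] at this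
  have hdisj : Disjoint (univ.image fun i : Fin d => u + Pi.single i 1)
      (univ.image fun i : Fin d => u - Pi.single i 1) := by
    rw [disjoint_left]
    intro v hv hv'
    obtain ⟨i, -, rfl⟩ := mem_image.mp hv
    obtain ⟨k, -, hk⟩ := mem_image.mp hv'
    have h := congrFun hk i
    by_cases hik : i = k
    · subst hik
      simp only [Pi.sub_apply, Pi.add_apply, Pi.single_eq_same] at h
      exact htwo (by linear_combination -h)
    · simp [Pi.single_eq_of_ne hik] at h
  have hN : nbrsIn (torusGraph ℓ d) u univ = (univ.image fun i : Fin d => u + Pi.single i 1)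
      ∪ (univ.image fun i : Fin d => u - Pi.single i 1) := by
    ext v
    rw [mem_nbrsIn, torusGraph_adj hℓ]
    simp
  rw [hN, sum_union hdisj, sum_image fun i _ k _ h => hinj (add_left_cancel h),
    sum_image fun i _ k _ h => hinj (sub_right_injective h), sum_add_distrib]

theorem card_nbrsIn_torusGraph {ℓ d : ℕ} [NeZero ℓ] (hℓ : 3 ≤ ℓ) (u : Fin d → ZMod ℓ) :
    (nbrsIn (torusGraph ℓ d) u univ).card = 2 * d := by
  have h := sum_nbrsIn_torusGraph hℓ u fun _ => 1
  simp only [sum_const, nsmul_eq_mul, mul_one, card_univ, Fintype.card_fin] at h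
  have : ((nbrsIn (torusGraph ℓ d) u univ).card : ℝ) = ((2 * d : ℕ) : ℝ) := by
    push_cast
    linarith
  exact_mod_cast this

/-- The Green kernel of the walk up to time `r`. -/
def green {ℓ d : ℕ} [NeZero ℓ] (a : ℝ) (r : ℕ) (u w : Fin d → ZMod ℓ) : ℝ :=
  a * ∑ j ∈ range r, heat a j (u - w)

variable {ℓ d : ℕ} [NeZero ℓ] {a : ℝ}

theorem green_symm (r : ℕ) (u w : Fin d → ZMod ℓ) : green a r u w = green a r w u := by
  unfold green
  congr 1
  exact sum_congr rfl fun j _ => by rw [← heat_neg, neg_sub]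

theorem green_succ (hℓ : 3 ≤ ℓ) (r : ℕ) {u w : Fin d → ZMod ℓ} (huw : u ≠ w) :
    green a (r + 1) u w = green a r u w
      + a * ∑ v ∈ nbrsIn (torusGraph ℓ d) u univ, (green a r v w - green a r u w) := by
  have h1 : ∑ v ∈ nbrsIn (torusGraph ℓ d) u univ, (green a r v w - green a r u w)
      = ∑ j ∈ range r, (heat a (j + 1) (u - w) - heat a j (u - w)) := by
    unfold green
    simp only [← mul_sub, ← sum_sub_distrib, ← mul_sum]
    rw [sum_comm, mul_sum]
    refine sum_congr rfl fun j _ => ?_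
    rw [heat_succ, sum_nbrsIn_torusGraph hℓ, add_sub_cancel_left]
    congr 1
    refine sum_congr rfl fun i _ => ?_
    rw [show u + Pi.single i 1 - w = u - w + Pi.single i 1 by abel,
      show u - Pi.single i 1 - w = u - w - Pi.single i 1 by abel]
    ring
  rw [h1, sum_range_sub (fun j => heat a j (u - w)), heat_zero,
    if_neg (sub_ne_zero.mpr huw), sub_zero]
  unfold green
  rw [sum_range_succ, mul_add]

theorem card_sq_div_le_sum_green (ha : 0 ≤ a) (had : 4 * d * a ≤ 1) (r : ℕ)
    (F : Finset (Fin d → ZMod ℓ)) :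
    a * r * ((F.card : ℝ) ^ 2 / (ℓ : ℝ) ^ d) ≤ ∑ u ∈ F, ∑ w ∈ F, green a r u w := by
  have e : ∑ u ∈ F, ∑ w ∈ F, green a r u w
      = a * ∑ j ∈ range r, ∑ u ∈ F, ∑ w ∈ F, heat a j (u - w) := by
    unfold green
    simp only [← mul_sum]
    congr 1
    rw [sum_comm (s := range r)]
    exact sum_congr rfl fun u _ => sum_comm
  rw [e, mul_assoc]
  gcongr
  calc (r : ℝ) * ((F.card : ℝ) ^ 2 / (ℓ : ℝ) ^ d)
      = ∑ _j ∈ range r, (F.card : ℝ) ^ 2 / (ℓ : ℝ) ^ d := by simp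
    _ ≤ _ := sum_le_sum fun j _ => card_sq_div_le_sum_heat ha had j F

end Torus

/-- For the KCIP on the torus `Λ(L,d)` with `p = c/n`, there exist constants
`C₁, C₂` and `N` depending only on `c` and `d` such that for every
`0 < ε ≤ 1/(96c²(d+1)³)`, every `n = (L+1)^d > N`, every initial configuration `x` and every
integer `s` with `n log n ≤ s ≤ n³/(96c²d³)`: `E_x[Ỹ_s] ≤ (1 + C₁ ε) Ỹ_0(x) + C₂`. -/
theorem kcip_correctedY_growth (c : ℝ) (hc : 0 < c) (d : ℕ) (hd : 3 ≤ d) :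
    ∃ C₁ C₂ : ℝ, ∃ N : ℕ,
      ∀ ε : ℝ, 0 < ε → ε ≤ 1 / (96 * c ^ 2 * ((d : ℝ) + 1) ^ 3) →
      ∀ L : ℕ, N < (L + 1) ^ d →
      ∀ x : (Fin d → ZMod (L + 1)) → Bool, ∀ s : ℕ,
        (((L + 1) ^ d : ℕ) : ℝ) * Real.log (((L + 1) ^ d : ℕ) : ℝ) ≤ (s : ℝ) →
        (s : ℝ) ≤ (((L + 1) ^ d : ℕ) : ℝ) ^ 3 / (96 * c ^ 2 * (d : ℝ) ^ 3) →
        trajExp (kcipKernel (torusGraph (L + 1) d) (c / (((L + 1) ^ d : ℕ) : ℝ))) x s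
            (fun ω => correctedY (torusGraph (L + 1) d) (ω (Fin.last s))) ≤
          (1 + C₁ * ε) * correctedY (torusGraph (L + 1) d) x + C₂ := by
  obtain ⟨C, N, hmain⟩ := exists_iterate_setStep_le (T := 1 / (96 * c ^ 2 * (d : ℝ) ^ 3))
    (g := 24 ^ d) hc (by positivity) (2 * d)
    fun η => max 1 ((24 ^ d * 6 / η) ^ 2) + 1
  obtain ⟨M, hM⟩ := exists_nat_gt (4 * d * c)
  refine ⟨0, C, N + M + 2 ^ d, ?_⟩
  intro ε _ _ L hL x s _ hs
  have hcard : Fintype.card (Fin d → ZMod (L + 1)) = (L + 1) ^ d := by simp [ZMod.card]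
  have hpow : 0 < 2 ^ d := by positivity
  have hℓ : 3 ≤ L + 1 := by
    by_contra h
    have : (L + 1) ^ d ≤ 2 ^ d := Nat.pow_le_pow_left (by omega) d
    omega
  simp only [correctedY_eq_finalExp]
  rw [trajExp_kcipKernel _ _ (finalExp (torusGraph (L + 1) d) fun F => (F.card : ℝ)), zero_mul,
    add_zero, one_mul, ← hcard]
  have hnℓ : (((L + 1 : ℕ) : ℝ)) ^ d = Fintype.card (Fin d → ZMod (L + 1)) := by
    rw [hcard]
    push_cast
    rfl
  rw [← hcard] at hs hL
  set n : ℝ := (Fintype.card (Fin d → ZMod (L + 1)) : ℝ) with hn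
  have hMn : 4 * d * c ≤ n := by
    have : (M : ℝ) ≤ n := by
      rw [hn]
      exact_mod_cast (show M ≤ Fintype.card (Fin d → ZMod (L + 1)) by omega)
    linarith
  have hn1 : 1 ≤ n := by
    rw [hn]
    exact_mod_cast Fintype.card_pos
  have hn0 : 0 < n := by linarith
  have ha : 0 < c / n ^ 2 := by positivity
  have had : 4 * d * (c / n ^ 2) ≤ 1 := by
    rw [← mul_div_assoc, div_le_one (by positivity)]
    nlinarith
  have ha1 : c / n ^ 2 ≤ 1 := by
    have : (3 : ℝ) ≤ d := by exact_mod_cast hd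
    nlinarith
  refine hmain (torusGraph (L + 1) d) (by omega) (fun v => (card_nbrsIn_torusGraph hℓ v).le)
    (green (c / n ^ 2)) (fun u v => by simp [green]) green_symm
    (fun r u v => mul_nonneg ha.le (sum_nonneg fun j _ => heat_nonneg ha.le had j _))
    (fun r u w huw => green_succ hℓ r huw) (fun r F => ?_) (fun η hη r F y => ?_) s (particles x) ?_
  · refine le_of_eq_of_le ?_ (card_sq_div_le_sum_green ha.le had r F)
    rw [hnℓ, ← hn]
    field_simp
  · set τ : ℝ := max 1 ((24 ^ d * 6 / η) ^ 2) with hτ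
    have hτ1 : 1 ≤ τ := le_max_left _ _
    refine (sum_heat_sub_le ha ha1 had hd hτ1 r F y).trans ?_
    rw [hnℓ, ← hn]
    have h1 : 24 ^ d * (6 / √τ) ≤ η := by
      have h2 : 24 ^ d * 6 / η ≤ √τ := Real.le_sqrt_of_sq_le (le_max_right _ _)
      rw [div_le_iff₀ hη] at h2
      rw [← mul_div_assoc, div_le_iff₀ (Real.sqrt_pos.mpr (by linarith))]
      linarith
    have h2 : c / n ^ 2 * r / n = c * r / n ^ 3 := by
      field_simp
    rw [h2]
    gcongr
  · rw [one_div_mul_eq_div]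
    exact hs
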